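/- Let X be a shift space with language 𝓛 = 𝓛(X) and let φ : X → ℝ be continuous. Suppose 𝓖 ⊂ 𝓛 has (W)-specification and 𝓛 is edit approachable by 𝓖. Then for any continuous ψ : X → ℝ and any α ∈ ℝ, the level set X(ψ,α) satisfies the conditional variational principle P_{X(ψ,α)}(φ) = sup{ h_μ(σ) + ∫ φ dμ : μ ∈ M_σ(X), ∫ ψ dμ = α }. -/

import Mathlib

open MeasureTheory Filter Topology Set
open scoped ENNReal Classical

namespace Paper

variable {A : Type} [Fintype A] [DecidableEq A] [TopologicalSpace A] [DiscreteTopology A]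
  [MeasurableSpace A] [BorelSpace A]

/-- The left shift map on the full shift `A^ℕ`. -/
def shift : (ℕ → A) → (ℕ → A) := fun x i => x (i + 1)

/-- The cylinder set of a finite word `w`: points whose initial word is `w`. -/
def cylinder (w : List A) : Set (ℕ → A) := {x | ∀ i : Fin w.length, x i = w.get i}

/-- The language of `X`: finite words `w` with `[w] ∩ X ≠ ∅`. -/
def language (X : Set (ℕ → A)) : Set (List A) := {w | (cylinder w ∩ X).Nonempty}

/-- One edit of a word: a substitution, an insertion, or a deletion. -/
def EditStep (w w' : List A) : Prop :=
  (∃ u₁ u₂ : List A, ∃ a a' : A, w = u₁ ++ [a] ++ u₂ ∧ w' = u₁ ++ [a'] ++ u₂) ∨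
  (∃ u₁ u₂ : List A, ∃ a' : A, w = u₁ ++ u₂ ∧ w' = u₁ ++ [a'] ++ u₂) ∨
  (∃ u₁ u₂ : List A, ∃ a : A, w = u₁ ++ [a] ++ u₂ ∧ w' = u₁ ++ u₂)

/-- The edit distance: the minimal number of edits transforming `v` into `w`. -/
noncomputable def editDist (v w : List A) : ℕ :=
  sInf {n | ∃ f : ℕ → List A, f 0 = v ∧ f n = w ∧ ∀ i < n, EditStep (f i) (f (i + 1))}

/-- `G ⊆ L` has (W)-specification (with some gap length `τ`). -/
def HasSpecW (L G : Set (List A)) : Prop :=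
  ∃ τ : ℕ, ∀ v ∈ G, ∀ w ∈ G, ∃ u ∈ L, u.length ≤ τ ∧ v ++ u ++ w ∈ G

/-- A mistake function: nondecreasing with `g n / n → 0`. -/
def MistakeFun (g : ℕ → ℕ) : Prop :=
  Monotone g ∧ Tendsto (fun n => (g n : ℝ) / n) atTop (𝓝 0)

/-- `L` is edit approachable by `G`. -/
def EditApproachable (L G : Set (List A)) : Prop :=
  ∃ g : ℕ → ℕ, MistakeFun g ∧ ∀ w ∈ L, ∃ v ∈ G, editDist v w ≤ g w.length

/-- The shift map restricted to a (shift-invariant) subset `X`, as a self-map of `↥X`. -/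
noncomputable def subShift (X : Set (ℕ → A)) : ↥X → ↥X := fun x =>
  if h : shift x.val ∈ X then ⟨shift x.val, h⟩ else x

/-- Birkhoff sum `S_n φ = ∑_{i<n} φ ∘ σ^i`. -/
def birkhoff {Y : Type*} (σ : Y → Y) (φ : Y → ℝ) (n : ℕ) (y : Y) : ℝ :=
  ∑ i ∈ Finset.range n, φ (σ^[i] y)

/-- The Birkhoff average `(1/n) S_n φ`. -/
noncomputable def birkAvg {Y : Type*} (σ : Y → Y) (φ : Y → ℝ) (n : ℕ) (y : Y) : ℝ :=
  (n : ℝ)⁻¹ * birkhoff σ φ n y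

/-- Carathéodory sum `M(Z,t,φ,N)` over covers of `Z` by cylinders of length `> N`. -/
noncomputable def Mcal (X : Set (ℕ → A)) (φ : ↥X → ℝ) (Z : Set ↥X) (t : ℝ) (N : ℕ) : ℝ≥0∞ :=
  ⨅ (S : Set (List A)) (_ : S.Countable) (_ : ∀ w ∈ S, N < w.length)
    (_ : Z ⊆ ⋃ w ∈ S, Subtype.val ⁻¹' cylinder w),
    ∑' w : S, ENNReal.ofReal (Real.exp (-t * (w : List A).length +
      sSup (birkhoff (subShift X) φ (w : List A).length ''
        (Subtype.val ⁻¹' cylinder (w : List A)))))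

/-- `M(Z,t,φ) = lim_{N→∞} M(Z,t,φ,N)` (the limit of a nondecreasing quantity). -/
noncomputable def McalLim (X : Set (ℕ → A)) (φ : ↥X → ℝ) (Z : Set ↥X) (t : ℝ) : ℝ≥0∞ :=
  ⨆ N : ℕ, Mcal X φ Z t N

/-- The topological pressure `P_Z(φ)` of `Z ⊆ X`. -/
noncomputable def pressure (X : Set (ℕ → A)) (φ : ↥X → ℝ) (Z : Set ↥X) : ℝ :=
  sInf {t : ℝ | McalLim X φ Z t = 0}

/-- The empirical measure `ℰ_n(x) = (1/n) ∑_{i<n} δ_{σ^i x}`. -/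
noncomputable def empiric {Y : Type*} [MeasurableSpace Y] (σ : Y → Y) (n : ℕ) (x : Y) :
    Measure Y := (n : ℝ≥0∞)⁻¹ • ∑ i ∈ Finset.range n, Measure.dirac (σ^[i] x)

/-- The set `A(ℰ_n(x))` of weak* limit points of the sequence of empirical measures of `x`:
probability measures that are limits of the empirical measures along a subsequence. -/
def limitPts {Y : Type*} [MeasurableSpace Y] [TopologicalSpace Y] (σ : Y → Y) (x : Y) :
    Set (ProbabilityMeasure Y) :=
  {μ | ∃ φ : ℕ → ℕ, StrictMono φ ∧ ∀ f : C(Y, ℝ),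
      Tendsto (fun k => birkAvg σ (fun y => f y) (φ k) x) atTop (𝓝 (∫ y, f y ∂μ.toMeasure))}

/-- The saturated set `G_K = {x : A(ℰ_n(x)) = K}`. -/
def saturated {Y : Type*} [MeasurableSpace Y] [TopologicalSpace Y] (σ : Y → Y)
    (K : Set (ProbabilityMeasure Y)) : Set Y := {x | limitPts σ x = K}

/-- The generic points of `μ`: those `x` with `ℰ_n(x) → μ` in the weak* topology. -/
def genericPts {Y : Type*} [MeasurableSpace Y] [TopologicalSpace Y] (σ : Y → Y)
    (μ : ProbabilityMeasure Y) : Set Y :=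
  {x | ∀ f : C(Y, ℝ),
      Tendsto (fun n => birkAvg σ (fun y => f y) n x) atTop (𝓝 (∫ y, f y ∂μ.toMeasure))}

/-- `μ` is a `σ`-invariant (probability) measure. -/
def IsInvariant {Y : Type*} [MeasurableSpace Y] (σ : Y → Y) (μ : ProbabilityMeasure Y) : Prop :=
  μ.toMeasure.map σ = μ.toMeasure

/-- The level set `X(ψ,α)` of points whose Birkhoff averages of `ψ` converge to `α`. -/
def levelSet {Y : Type*} (σ : Y → Y) (ψ : Y → ℝ) (α : ℝ) : Set Y :=
  {x | Tendsto (fun n => birkAvg σ ψ n x) atTop (𝓝 α)}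

/-- The irregular set `X̂(ψ)` of points whose Birkhoff averages of `ψ` do not converge. -/
def irregular {Y : Type*} (σ : Y → Y) (ψ : Y → ℝ) : Set Y :=
  {x | ¬ ∃ α : ℝ, Tendsto (fun n => birkAvg σ ψ n x) atTop (𝓝 α)}

/-- The cylinder of a word of length `n` given as `w : Fin n → A`. -/
def cylF {n : ℕ} (w : Fin n → A) : Set (ℕ → A) := {x | ∀ i : Fin n, x i = w i}

/-- The entropy `H_n(μ)` of the partition of `X` into cylinders of length `n`. -/
noncomputable def wordEntropy (X : Set (ℕ → A)) (μ : ProbabilityMeasure ↥X) (n : ℕ) : ℝ :=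
  ∑ w : Fin n → A, Real.negMulLog ((μ.toMeasure (Subtype.val ⁻¹' cylF w)).toReal)

/-- The measure-theoretic (Kolmogorov–Sinai) entropy `h_μ(σ)` of a shift-invariant measure on a
subshift: by subadditivity, `lim_n H_n/n = inf_{n ≥ 1} H_n/n`. -/
noncomputable def entropy (X : Set (ℕ → A)) (μ : ProbabilityMeasure ↥X) : ℝ :=
  ⨅ n : ℕ, wordEntropy X μ (n + 1) / (n + 1)

/-- The distance `D` on measures induced by a countable family of continuous functions. -/
noncomputable def Dmetric {Y : Type*} [MeasurableSpace Y] [TopologicalSpace Y]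
    (f : ℕ → C(Y, ℝ)) (μ ν : Measure Y) : ℝ :=
  ∑' k : ℕ, ((2 : ℝ) ^ (k + 1))⁻¹ * |(∫ y, f k y ∂μ) - ∫ y, f k y ∂ν|

/-- The family `f` is separating: `D` separates Borel probability measures. -/
def Separating {Y : Type*} [MeasurableSpace Y] [TopologicalSpace Y] (f : ℕ → C(Y, ℝ)) : Prop :=
  ∀ μ ν : ProbabilityMeasure Y,
    (∀ k, (∫ y, f k y ∂μ.toMeasure) = ∫ y, f k y ∂ν.toMeasure) → μ = ν

/-- Diameter of a set with respect to a distance function `d`, valued in `ℝ≥0∞`. -/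
noncomputable def ediam {Y : Type*} (d : Y → Y → ℝ) (U : Set Y) : ℝ≥0∞ :=
  ⨆ x ∈ U, ⨆ y ∈ U, ENNReal.ofReal (d x y)

/-- The `s`-dimensional Hausdorff pre-measure at scale `ε` w.r.t. the distance `d`. -/
noncomputable def hMeasAux {Y : Type*} (d : Y → Y → ℝ) (s : ℝ) (ε : ℝ≥0∞) (Z : Set Y) : ℝ≥0∞ :=
  ⨅ (C : ℕ → Set Y) (_ : Z ⊆ ⋃ n, C n) (_ : ∀ n, ediam d (C n) ≤ ε),
    ∑' n, ⨆ (_ : (C n).Nonempty), ediam d (C n) ^ s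

/-- The `s`-dimensional Hausdorff measure w.r.t. the distance `d`. -/
noncomputable def hMeas {Y : Type*} (d : Y → Y → ℝ) (s : ℝ) (Z : Set Y) : ℝ≥0∞ :=
  ⨆ (ε : ℝ≥0∞) (_ : 0 < ε), hMeasAux d s ε Z

/-- The Hausdorff dimension of `Z` w.r.t. the distance `d`. -/
noncomputable def hdim {Y : Type*} (d : Y → Y → ℝ) (Z : Set Y) : ℝ :=
  sInf {s : ℝ | 0 ≤ s ∧ hMeas d s Z = 0}

/-- The length `|x ∧ y|` of the longest common prefix of two distinct points. -/
noncomputable def wedge (x y : ℕ → A) : ℕ := sInf {n | x n ≠ y n}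

/-- The Gatzouras–Peres distance `d_φ` associated with a strictly positive continuous `φ`. -/
noncomputable def dphi (X : Set (ℕ → A)) (φ : ↥X → ℝ) (x y : ↥X) : ℝ :=
  if x = y then 0
  else Real.exp (-(sSup (birkhoff (subShift X) φ (wedge x.val y.val) ''
      {z : ↥X | ∀ i < wedge x.val y.val, z.val i = x.val i})))

/-- The word `w` occurs in `x` at position `k`. -/
def occursAt (w : List A) (x : ℕ → A) (k : ℕ) : Prop :=
  ∀ i : Fin w.length, x (k + i) = w.get i

/-- A shift of finite type: determined by a finite set of forbidden words. -/
def IsSFT {B : Type} (Z : Set (ℕ → B)) : Prop :=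
  ∃ F : Set (List B), F.Finite ∧ Z = {x | ∀ w ∈ F, ∀ k, ¬ occursAt w x k}

/-- A sofic shift: the image of a shift of finite type under a sliding block code. -/
def IsSofic (Y : Set (ℕ → A)) : Prop :=
  ∃ (B : Type) (_ : Fintype B) (Z : Set (ℕ → B)) (π : (ℕ → B) → (ℕ → A)),
    IsSFT Z ∧ Set.MapsTo shift Z Z ∧
    (∃ r : ℕ, ∀ z ∈ Z, ∀ z' ∈ Z, ∀ k, (∀ i ≤ k + r, z i = z' i) → π z k = π z' k) ∧
    (∀ z ∈ Z, π (shift z) = shift (π z)) ∧ π '' Z = Y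

/-- Topological transitivity of a subshift, via its language. -/
def IsTransitive (Y : Set (ℕ → A)) : Prop :=
  ∀ u ∈ language Y, ∀ v ∈ language Y, ∃ w : List A, u ++ w ++ v ∈ language Y

/-- The prefix of length `n` of `x`, as a word. -/
def prefixWord (x : ℕ → A) (n : ℕ) : List A := List.ofFn fun i : Fin n => x i

/-- The norm `‖m‖ = sup_{0 < ‖f‖ ≤ 1} |∫ f dm| / ‖f‖` of a measure on a compact space. -/
noncomputable def mnorm {Y : Type*} [TopologicalSpace Y] [CompactSpace Y] [MeasurableSpace Y]
    (m : Measure Y) : ℝ :=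
  sSup ((fun f : C(Y, ℝ) => |∫ y, f y ∂m| / ‖f‖) '' {f : C(Y, ℝ) | 0 < ‖f‖ ∧ ‖f‖ ≤ 1})

/-- Strict lexicographic order on `ℕ`-indexed sequences of naturals. -/
def lexLt (x y : ℕ → ℕ) : Prop := ∃ n : ℕ, (∀ i < n, x i = y i) ∧ x n < y n

/-- The β-shift: all sequences over `{0, …, b-1}` all of whose shifts are lexicographically
below the expansion `w` of `1` in base `β` (where `b = ⌈β⌉`). -/
def betaShift (b : ℕ) (w : ℕ → ℕ) : Set (ℕ → Fin b) :=
  {x | ∀ j : ℕ, 1 ≤ j → lexLt (fun i => ((shift^[j] x) i : ℕ)) w}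

/-- The S-gap shift: sequences over `{0,1}` such that the number of `0`s between any two
consecutive `1`s lies in `S`. -/
def sGapShift (S : Set ℕ) : Set (ℕ → Fin 2) :=
  {x | ∀ k l : ℕ, k < l → x k = 1 → x l = 1 →
    (∀ m : ℕ, k < m → m < l → x m = 0) → l - k - 1 ∈ S}

section Words

variable {B : Type}

/-- `v` and `w` have a common subword missing at most `k` letters of each of them. -/
def CommonSub (k : ℕ) (v w : List B) : Prop :=
  ∃ s : List B, s.Sublist v ∧ s.Sublist w ∧ v.length ≤ s.length + k ∧ w.length ≤ s.length + k

lemma CommonSub.refl (v : List B) : CommonSub 0 v v :=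
  ⟨v, List.Sublist.refl v, List.Sublist.refl v, by simp, by simp⟩

lemma CommonSub.mono {k l : ℕ} {v w : List B} (h : CommonSub k v w) (hkl : k ≤ l) :
    CommonSub l v w := by
  obtain ⟨s, h1, h2, h3, h4⟩ := h
  exact ⟨s, h1, h2, by omega, by omega⟩

lemma CommonSub.append {k l : ℕ} {v w v' w' : List B} (h : CommonSub k v w)
    (h' : CommonSub l v' w') : CommonSub (k + l) (v ++ v') (w ++ w') := by
  obtain ⟨s, h1, h2, h3, h4⟩ := h
  obtain ⟨s', h1', h2', h3', h4'⟩ := h'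
  refine ⟨s ++ s', h1.append h1', h2.append h2', ?_, ?_⟩ <;> simp only [List.length_append] <;>
    omega

lemma CommonSub.append_left {k : ℕ} {v w : List B} (h : CommonSub k v w) (u : List B) :
    CommonSub (u.length + k) (u ++ v) w := by
  obtain ⟨s, h1, h2, h3, h4⟩ := h
  refine ⟨s, h1.trans (List.sublist_append_right u v), h2, ?_, by omega⟩
  simp only [List.length_append]; omega

lemma CommonSub.length_le {k : ℕ} {v w : List B} (h : CommonSub k v w) :
    v.length ≤ w.length + k ∧ w.length ≤ v.length + k := by
  obtain ⟨s, h1, h2, h3, h4⟩ := h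
  have := h1.length_le
  have := h2.length_le
  omega

lemma sublist_remove_letter {s u₁ u₂ : List B} {a : B} (h : s.Sublist (u₁ ++ [a] ++ u₂)) :
    ∃ s' : List B, s'.Sublist s ∧ s'.Sublist (u₁ ++ u₂) ∧ s.length ≤ s'.length + 1 := by
  obtain ⟨l, l₂, rfl, hl, h₂⟩ := List.sublist_append_iff.1 h
  obtain ⟨l₁, m, rfl, h₁, hm⟩ := List.sublist_append_iff.1 hl
  refine ⟨l₁ ++ l₂, ?_, h₁.append h₂, ?_⟩
  · exact (List.sublist_append_left l₁ m).append (List.Sublist.refl l₂)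
  · have := hm.length_le
    simp only [List.length_append, List.length_singleton] at this ⊢
    omega

lemma CommonSub.editStep {k : ℕ} {v w w' : List B} (h : CommonSub k v w) (hw : EditStep w w') :
    CommonSub (k + 1) v w' := by
  obtain ⟨s, h1, h2, h3, h4⟩ := h
  have ins : ∀ (u₁ u₂ : List B) (a : B), (u₁ ++ u₂).Sublist (u₁ ++ [a] ++ u₂) := fun u₁ u₂ a =>
    (List.sublist_append_left u₁ [a]).append (List.Sublist.refl u₂)
  rcases hw with ⟨u₁, u₂, a, a', rfl, rfl⟩ | ⟨u₁, u₂, a', rfl, rfl⟩ | ⟨u₁, u₂, a, rfl, rfl⟩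
  · obtain ⟨s', hs, hs', hl⟩ := sublist_remove_letter h2
    refine ⟨s', hs.trans h1, hs'.trans (ins _ _ _), by omega, ?_⟩
    simp only [List.length_append, List.length_singleton] at h4 ⊢
    omega
  · refine ⟨s, h1, h2.trans (ins _ _ _), by omega, ?_⟩
    simp only [List.length_append, List.length_singleton] at h4 ⊢
    omega
  · obtain ⟨s', hs, hs', hl⟩ := sublist_remove_letter h2
    refine ⟨s', hs.trans h1, hs', by omega, ?_⟩
    simp only [List.length_append, List.length_singleton] at h4 ⊢
    omega

lemma exists_edit_path (v w : List B) :
    ∃ n, ∃ f : ℕ → List B, f 0 = v ∧ f n = w ∧ ∀ i < n, EditStep (f i) (f (i + 1)) := by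
  have del : ∀ v : List B, Relation.ReflTransGen EditStep v [] := by
    intro v
    induction v with
    | nil => exact .refl
    | cons a v ih => exact .head (.inr (.inr ⟨[], v, a, by simp, by simp⟩)) ih
  have ins : ∀ w : List B, Relation.ReflTransGen EditStep [] w := by
    intro w
    induction w with
    | nil => exact .refl
    | cons a w ih => exact .tail ih (.inr (.inl ⟨[], w, a, by simp, by simp⟩))
  have key : ∀ w, Relation.ReflTransGen EditStep v w →
      ∃ n, ∃ f : ℕ → List B, f 0 = v ∧ f n = w ∧ ∀ i < n, EditStep (f i) (f (i + 1)) := by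
    intro w h
    induction h with
    | refl => exact ⟨0, fun _ => v, rfl, rfl, by simp⟩
    | @tail b c _ hbc ih =>
      obtain ⟨n, f, h0, hn, hf⟩ := ih
      refine ⟨n + 1, fun i => if i ≤ n then f i else c, by simp [h0], by simp, ?_⟩
      intro i hi
      rcases Nat.lt_succ_iff_lt_or_eq.1 hi with hi | rfl
      · simpa [hi.le, Nat.succ_le_iff.2 hi] using hf i hi
      · simpa [hn] using hbc
  exact key w ((del v).trans (ins w))

lemma commonSub_of_editDist_le {k : ℕ} {v w : List B} (h : editDist v w ≤ k) :
    CommonSub k v w := by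
  obtain ⟨f, h0, hn, hf⟩ := Nat.sInf_mem (exists_edit_path v w)
  refine CommonSub.mono ?_ h
  have : ∀ i ≤ editDist v w, CommonSub i v (f i) := by
    intro i
    induction i with
    | zero => intro _; rw [h0]; exact CommonSub.refl v
    | succ i ih => intro hi; exact (ih (by omega)).editStep (hf i hi)
  have h' := this _ le_rfl
  rwa [show f (editDist v w) = w from hn] at h'

lemma exists_remove_letter {s v : List B} (h : s.Sublist v) (hl : s.length < v.length) :
    ∃ u₁ u₂ a, v = u₁ ++ [a] ++ u₂ ∧ s.Sublist (u₁ ++ u₂) := by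
  induction h with
  | slnil => simp at hl
  | @cons l₁ l₂ a h _ => exact ⟨[], l₂, a, by simp, by simpa using h⟩
  | @cons_cons l₁ l₂ a h ih =>
    obtain ⟨u₁, u₂, b, rfl, hs⟩ := ih (by simpa using hl)
    exact ⟨a :: u₁, u₂, b, by simp, by simpa using hs⟩

/-- A function on words that is additive under concatenation up to the error `K`. -/
structure QuasiAdd (S : List B → ℝ) (K : ℝ) : Prop where
  append : ∀ u v, |S (u ++ v) - S u - S v| ≤ K
  single : ∀ a, |S [a]| ≤ K

lemma QuasiAdd.nil_le {S : List B → ℝ} {K : ℝ} (h : QuasiAdd S K) : |S []| ≤ K := by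
  simpa using h.append [] []

lemma QuasiAdd.nonneg {S : List B → ℝ} {K : ℝ} (h : QuasiAdd S K) : 0 ≤ K :=
  (abs_nonneg _).trans h.nil_le

lemma QuasiAdd.sublist {S : List B → ℝ} {K : ℝ} (h : QuasiAdd S K) {s v : List B}
    (hs : s.Sublist v) {k : ℕ} (hk : v.length ≤ s.length + k) : |S v - S s| ≤ 5 * K * k := by
  induction k generalizing v with
  | zero => rw [hs.eq_of_length_le (by simpa using hk)]; simp
  | succ k ih =>
    have hK := h.nonneg
    rcases hs.length_le.lt_or_eq with hl | hl
    · obtain ⟨u₁, u₂, a, rfl, hs'⟩ := exists_remove_letter hs hl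
      have := ih hs' (by simp at hk ⊢; omega)
      have h1 := h.append (u₁ ++ [a]) u₂
      have h2 := h.append u₁ [a]
      have h3 := h.append u₁ u₂
      have h4 := h.single a
      rw [abs_le] at *
      push_cast
      constructor <;> linarith [this.1, this.2, h1.1, h1.2, h2.1, h2.2, h3.1, h3.2, h4.1, h4.2]
    · rw [hs.eq_of_length hl]; simp; positivity

lemma QuasiAdd.commonSub {S : List B → ℝ} {K : ℝ} (h : QuasiAdd S K) {v w : List B} {k : ℕ}
    (hk : CommonSub k v w) : |S v - S w| ≤ 10 * K * k := by
  obtain ⟨s, h1, h2, h3, h4⟩ := hk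
  have := h.sublist h1 h3
  have := h.sublist h2 h4
  calc |S v - S w| = |(S v - S s) - (S w - S s)| := by ring_nf
    _ ≤ |S v - S s| + |S w - S s| := abs_sub _ _
    _ ≤ 10 * K * k := by linarith

lemma QuasiAdd.flatten {S : List B → ℝ} {K : ℝ} (h : QuasiAdd S K) (L : List (List B)) :
    |S L.flatten - (L.map S).sum| ≤ K * (L.length + 1) := by
  induction L with
  | nil => simpa using h.nil_le
  | cons w L ih =>
    have h1 := h.append w L.flatten
    simp only [List.flatten_cons, List.map_cons, List.sum_cons, List.length_cons]
    push_cast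
    rw [abs_le] at *
    constructor <;> linarith [ih.1, ih.2, h1.1, h1.2]

end Words

section Counting

variable {B : Type}

lemma sum_sublists_pow_le (v : List B) {z : ℝ} (hz : 0 ≤ z) :
    ∑ s ∈ v.sublists.toFinset, z ^ (v.length - s.length) ≤ (1 + z) ^ v.length := by
  induction v with
  | nil => simp
  | cons a v ih =>
    have hsub : (a :: v).sublists.toFinset ⊆
        v.sublists.toFinset ∪ v.sublists.toFinset.image (List.cons a) := by
      intro s hs
      simp only [List.mem_toFinset, List.mem_sublists, Finset.mem_union, Finset.mem_image] at hs ⊢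
      rcases List.sublist_cons_iff.1 hs with h | ⟨r, rfl, h⟩
      · exact .inl h
      · exact .inr ⟨r, h, rfl⟩
    have hnn : ∀ s : List B, 0 ≤ z ^ ((a :: v).length - s.length) := fun s => pow_nonneg hz _
    have h1 : ∑ s ∈ v.sublists.toFinset, z ^ ((a :: v).length - s.length) ≤
        z * (1 + z) ^ v.length := by
      refine le_trans (le_of_eq ?_) (mul_le_mul_of_nonneg_left ih hz)
      rw [Finset.mul_sum]
      refine Finset.sum_congr rfl fun s hs => ?_
      have : s.length ≤ v.length := (List.mem_sublists.1 (List.mem_toFinset.1 hs)).length_le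
      rw [← pow_succ', List.length_cons, Nat.succ_sub this]
    have h2 : ∑ s ∈ v.sublists.toFinset.image (List.cons a),
        z ^ ((a :: v).length - s.length) ≤ (1 + z) ^ v.length := by
      rw [Finset.sum_image (fun x _ y _ h => by simpa using h)]
      simpa using ih
    calc _ ≤ ∑ s ∈ v.sublists.toFinset ∪ v.sublists.toFinset.image (List.cons a),
          z ^ ((a :: v).length - s.length) :=
          Finset.sum_le_sum_of_subset_of_nonneg hsub fun s _ _ => hnn s
      _ ≤ z * (1 + z) ^ v.length + (1 + z) ^ v.length := by
          have := Finset.sum_union_inter (s₁ := v.sublists.toFinset)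
            (s₂ := v.sublists.toFinset.image (List.cons a))
            (f := fun s => z ^ ((a :: v).length - s.length))
          have h3 : 0 ≤ ∑ s ∈ v.sublists.toFinset ∩ v.sublists.toFinset.image (List.cons a),
            z ^ ((a :: v).length - s.length) := Finset.sum_nonneg fun s _ => hnn s
          linarith
      _ = (1 + z) ^ (a :: v).length := by rw [List.length_cons, pow_succ]; ring

lemma sum_superwords_le [Fintype B] (n : ℕ) (s : List B) {z : ℝ} (hz : 0 ≤ z) :
    ∑ w : Fin n → B, (if s.Sublist (List.ofFn w) then z ^ (n - s.length) else 0) ≤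
      (1 + Fintype.card B * z) ^ n := by
  induction n generalizing s with
  | zero => simp; split_ifs <;> simp
  | succ n ih =>
    rw [← Equiv.sum_comp (Fin.consEquiv fun _ => B), Fintype.sum_prod_type]
    have hcons : ∀ (a : B) (w : Fin n → B),
        List.ofFn ((Fin.consEquiv fun _ : Fin (n + 1) => B) (a, w)) = a :: List.ofFn w :=
      fun a w => List.ofFn_cons a w
    simp only [hcons]
    have hpos : (0 : ℝ) ≤ (1 + Fintype.card B * z) ^ n := by positivity
    have skip : ∀ a : B, ∑ w : Fin n → B,
        (if s.Sublist (List.ofFn w) then z ^ (n + 1 - s.length) else 0) ≤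
        z * (1 + Fintype.card B * z) ^ n := by
      intro a
      refine le_trans (le_of_eq ?_) (mul_le_mul_of_nonneg_left (ih s) hz)
      rw [Finset.mul_sum]
      refine Finset.sum_congr rfl fun w _ => ?_
      split_ifs with h
      · have := h.length_le
        rw [List.length_ofFn] at this
        rw [← pow_succ', Nat.succ_sub this]
      · simp
    cases s with
    | nil =>
      simp only [List.nil_sublist, if_true] at skip ⊢
      calc _ ≤ ∑ a : B, z * (1 + Fintype.card B * z) ^ n := Finset.sum_le_sum fun a _ => skip a
        _ = Fintype.card B * z * (1 + Fintype.card B * z) ^ n := by simp; ring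
        _ ≤ _ := by rw [pow_succ]; nlinarith
    | cons b s =>
      have step : ∀ a : B, ∑ w : Fin n → B, (if (b :: s).Sublist (a :: List.ofFn w) then
          z ^ (n + 1 - (b :: s).length) else 0) ≤
          z * (1 + Fintype.card B * z) ^ n +
            if a = b then (1 + Fintype.card B * z) ^ n else 0 := by
        intro a
        have hle : ∀ w : Fin n → B, (if (b :: s).Sublist (a :: List.ofFn w) then
            z ^ (n + 1 - (b :: s).length) else 0) ≤
            (if (b :: s).Sublist (List.ofFn w) then z ^ (n + 1 - (b :: s).length) else 0) +
            if a = b then (if s.Sublist (List.ofFn w) then z ^ (n - s.length) else 0) else 0 := by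
          intro w
          have p1 := pow_nonneg hz (n + 1 - (b :: s).length)
          have p2 := pow_nonneg hz (n - s.length)
          by_cases h : (b :: s).Sublist (a :: List.ofFn w)
          · rcases List.sublist_cons_iff.1 h with h' | ⟨r, hr, h'⟩
            · rw [if_pos h, if_pos h']
              split_ifs <;> linarith
            · obtain ⟨rfl, rfl⟩ := List.cons.inj hr
              rw [if_pos h, if_pos rfl, if_pos h']
              simp only [List.length_cons, Nat.add_sub_add_right]
              split_ifs <;> linarith
          · rw [if_neg h]
            split_ifs <;> linarith
        refine (Finset.sum_le_sum fun w _ => hle w).trans ?_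
        rw [Finset.sum_add_distrib]
        refine add_le_add (skip a) ?_
        split_ifs with hab
        · exact ih s
        · simp
      calc _ ≤ ∑ a : B, (z * (1 + Fintype.card B * z) ^ n +
            if a = b then (1 + Fintype.card B * z) ^ n else 0) :=
            Finset.sum_le_sum fun a _ => step a
        _ = _ := by
          rw [Finset.sum_add_distrib]; simp; ring

lemma card_commonSub_le [Fintype B] {M k : ℕ} (V : List B) (T : Finset (List B))
    (hT : ∀ w ∈ T, w.length = M ∧ CommonSub k V w) {z : ℝ} (hz : 0 < z) (hz1 : z ≤ 1) :
    T.card * z ^ (2 * k) ≤ (1 + z) ^ V.length * (1 + Fintype.card B * z) ^ M := by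
  have hc : T.card ≤ (Finset.univ.filter fun w : Fin M → B => List.ofFn w ∈ T).card := by
    refine (Finset.card_le_card (t := (Finset.univ.filter fun w : Fin M → B =>
      List.ofFn w ∈ T).image List.ofFn) ?_).trans Finset.card_image_le
    intro w hw
    obtain ⟨rfl, -⟩ := hT w hw
    exact Finset.mem_image.2 ⟨w.get, by simpa using hw, by simp⟩
  calc (T.card : ℝ) * z ^ (2 * k)
      ≤ (Finset.univ.filter fun w : Fin M → B => List.ofFn w ∈ T).card * z ^ (2 * k) := by
        gcongr
    _ = ∑ w : Fin M → B, if List.ofFn w ∈ T then z ^ (2 * k) else 0 := by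
        rw [← Finset.sum_filter, Finset.sum_const, nsmul_eq_mul]
    _ ≤ ∑ w : Fin M → B, ∑ s ∈ V.sublists.toFinset, z ^ (V.length - s.length) *
          (if s.Sublist (List.ofFn w) then z ^ (M - s.length) else 0) := by
        refine Finset.sum_le_sum fun w _ => ?_
        have hnn : ∀ s ∈ V.sublists.toFinset, 0 ≤ z ^ (V.length - s.length) *
          (if s.Sublist (List.ofFn w) then z ^ (M - s.length) else 0) := by
          intro s _
          split_ifs <;> positivity
        split_ifs with hw
        · obtain ⟨s, h1, h2, h3, h4⟩ := (hT _ hw).2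
          refine le_trans ?_ (Finset.single_le_sum hnn (a := s) (by simpa using h1))
          rw [if_pos h2, ← pow_add]
          rw [List.length_ofFn] at h4
          exact pow_le_pow_of_le_one hz.le hz1 (by omega)
        · exact Finset.sum_nonneg hnn
    _ = ∑ s ∈ V.sublists.toFinset, z ^ (V.length - s.length) *
          ∑ w : Fin M → B, (if s.Sublist (List.ofFn w) then z ^ (M - s.length) else 0) := by
        rw [Finset.sum_comm]
        simp only [Finset.mul_sum]
    _ ≤ ∑ s ∈ V.sublists.toFinset, z ^ (V.length - s.length) *
          (1 + Fintype.card B * z) ^ M := by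
        gcongr with s hs
        exact sum_superwords_le M s hz.le
    _ ≤ _ := by
        rw [← Finset.sum_mul]
        gcongr
        exact sum_sublists_pow_le V hz.le

end Counting

section Typical

variable {W : Type*} [Fintype W]

lemma sum_cons_eq {m : ℕ} (F : (Fin (m + 1) → W) → ℝ) :
    ∑ t, F t = ∑ a, ∑ t : Fin m → W, F (Fin.cons a t) := by
  rw [← Equiv.sum_comp (Fin.consEquiv fun _ => W), Fintype.sum_prod_type]
  rfl

lemma product_moments {p f : W → ℝ} (hp1 : ∑ a, p a = 1) (hf : ∑ a, p a * f a = 0) (m : ℕ) :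
    (∑ t : Fin m → W, ∏ i, p (t i)) = 1 ∧
    (∑ t : Fin m → W, (∏ i, p (t i)) * ∑ i, f (t i)) = 0 ∧
    (∑ t : Fin m → W, (∏ i, p (t i)) * (∑ i, f (t i)) ^ 2) = m * ∑ a, p a * f a ^ 2 := by
  induction m with
  | zero => simp
  | succ m ih =>
    obtain ⟨h0, h1, h2⟩ := ih
    have e0 : (∑ t : Fin (m + 1) → W, ∏ i, p (t i)) = 1 := by
      rw [sum_cons_eq]
      simp [Fin.prod_univ_succ, ← Finset.mul_sum, h0, hp1]
    have e1 : (∑ t : Fin (m + 1) → W, (∏ i, p (t i)) * ∑ i, f (t i)) = 0 := by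
      rw [sum_cons_eq]
      have : ∀ a, (∑ t : Fin m → W, p a * (∏ i, p (t i)) * (f a + ∑ i, f (t i))) = p a * f a := by
        intro a
        calc _ = ∑ t : Fin m → W, (p a * f a * (∏ i, p (t i)) +
              p a * ((∏ i, p (t i)) * ∑ i, f (t i))) :=
              Finset.sum_congr rfl fun t _ => by ring
          _ = _ := by
            rw [Finset.sum_add_distrib, ← Finset.mul_sum, ← Finset.mul_sum, h0, h1]; ring
      simp [Fin.prod_univ_succ, Fin.sum_univ_succ, this, hf]
    refine ⟨e0, e1, ?_⟩
    rw [sum_cons_eq]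
    have : ∀ a, (∑ t : Fin m → W, p a * (∏ i, p (t i)) * (f a + ∑ i, f (t i)) ^ 2) =
        p a * f a ^ 2 + p a * (m * ∑ a, p a * f a ^ 2) := by
      intro a
      calc _ = ∑ t : Fin m → W, (p a * f a ^ 2 * (∏ i, p (t i)) +
            2 * p a * f a * ((∏ i, p (t i)) * ∑ i, f (t i)) +
            p a * ((∏ i, p (t i)) * (∑ i, f (t i)) ^ 2)) :=
            Finset.sum_congr rfl fun t _ => by ring
        _ = _ := by
          rw [Finset.sum_add_distrib, Finset.sum_add_distrib, ← Finset.mul_sum, ← Finset.mul_sum,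
            ← Finset.mul_sum, h0, h1, h2]
          ring
    simp only [Fin.prod_univ_succ, Fin.sum_univ_succ, Fin.cons_zero, Fin.cons_succ, this]
    rw [Finset.sum_add_distrib, ← Finset.sum_mul, hp1]
    push_cast
    ring

lemma deviation_mass_le {p f : W → ℝ} (hp : ∀ a, 0 ≤ p a) (hp1 : ∑ a, p a = 1) {ε : ℝ}
    (hε : 0 < ε) :
    ∀ᶠ m : ℕ in atTop, ∑ t : Fin m → W, (if |∑ i, f (t i) - m * ∑ a, p a * f a| ≤ ε * m then 0
      else ∏ i, p (t i)) ≤ 1 / 6 := by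
  set e := ∑ a, p a * f a with he
  set v := ∑ a, p a * (f a - e) ^ 2 with hv
  have hv0 : 0 ≤ v := Finset.sum_nonneg fun a _ => mul_nonneg (hp a) (sq_nonneg _)
  obtain ⟨m₀, hm₀⟩ := exists_nat_gt (6 * v / ε ^ 2)
  filter_upwards [eventually_ge_atTop (m₀ + 1)] with m hm
  have hmpos : (0 : ℝ) < m := by exact_mod_cast (by omega : 0 < m)
  have hf : ∑ a, p a * (f a - e) = 0 := by
    simp only [mul_sub, Finset.sum_sub_distrib, ← Finset.sum_mul, hp1, ← he]; ring
  have key := (product_moments hp1 hf m).2.2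
  have hsum : ∀ t : Fin m → W, ∑ i, (f (t i) - e) = ∑ i, f (t i) - m * e := by
    intro t; simp
  simp only [hsum] at key
  have hle : (ε * m) ^ 2 * ∑ t : Fin m → W, (if |∑ i, f (t i) - m * e| ≤ ε * m then 0
      else ∏ i, p (t i)) ≤ m * v := by
    rw [hv, ← key, Finset.mul_sum]
    refine Finset.sum_le_sum fun t _ => ?_
    have hP : 0 ≤ ∏ i, p (t i) := Finset.prod_nonneg fun i _ => hp _
    split_ifs with h
    · simp only [mul_zero]; positivity
    · rw [mul_comm, ← sq_abs (_ - _)]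
      push Not at h
      gcongr
  have hlt : 6 * v < ε ^ 2 * m := by
    rw [div_lt_iff₀ (by positivity)] at hm₀
    have : (m₀ : ℝ) ≤ m := by exact_mod_cast (by omega : m₀ ≤ m)
    nlinarith [sq_nonneg ε]
  by_contra! hcon
  have : (ε * m) ^ 2 * (1 / 6) < m * v := lt_of_lt_of_le (by gcongr) hle
  have : m * (ε ^ 2 * m) < m * (6 * v) := by linarith
  have := lt_of_mul_lt_mul_left this hmpos.le
  linarith

lemma exists_typical {p : W → ℝ} (hp : ∀ a, 0 ≤ p a) (hp1 : ∑ a, p a = 1) (f₁ f₂ : W → ℝ)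
    {ε : ℝ} (hε : 0 < ε) :
    ∀ᶠ m : ℕ in atTop, ∃ T : Finset (Fin m → W),
      (∀ t ∈ T, (∀ i, 0 < p (t i)) ∧ |∑ i, f₁ (t i) - m * ∑ a, p a * f₁ a| ≤ ε * m ∧
        |∑ i, f₂ (t i) - m * ∑ a, p a * f₂ a| ≤ ε * m) ∧
      Real.exp (m * (∑ a, Real.negMulLog (p a) - ε)) / 2 ≤ T.card := by
  filter_upwards [deviation_mass_le (f := f₁) hp hp1 hε, deviation_mass_le (f := f₂) hp hp1 hε,
    deviation_mass_le (f := fun a => -Real.log (p a)) hp hp1 hε] with m h1 h2 h3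
  have hH : ∑ a, p a * -Real.log (p a) = ∑ a, Real.negMulLog (p a) :=
    Finset.sum_congr rfl fun a _ => by rw [Real.negMulLog]; ring
  rw [hH] at h3
  set H := ∑ a, Real.negMulLog (p a)
  refine ⟨Finset.univ.filter fun t => (∀ i, 0 < p (t i)) ∧
    |∑ i, f₁ (t i) - m * ∑ a, p a * f₁ a| ≤ ε * m ∧
    |∑ i, f₂ (t i) - m * ∑ a, p a * f₂ a| ≤ ε * m ∧
    |∑ i, -Real.log (p (t i)) - m * H| ≤ ε * m, ?_, ?_⟩
  · intro t ht
    obtain ⟨a, b, c, -⟩ := (Finset.mem_filter.1 ht).2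
    exact ⟨a, b, c⟩
  set T := Finset.univ.filter fun t : Fin m → W => (∀ i, 0 < p (t i)) ∧
    |∑ i, f₁ (t i) - m * ∑ a, p a * f₁ a| ≤ ε * m ∧
    |∑ i, f₂ (t i) - m * ∑ a, p a * f₂ a| ≤ ε * m ∧
    |∑ i, -Real.log (p (t i)) - m * H| ≤ ε * m with hT
  have htot : (∑ t : Fin m → W, ∏ i, p (t i)) = 1 :=
    (product_moments (f := fun _ => 0) hp1 (by simp) m).1
  have hmass : (1 : ℝ) / 2 ≤ ∑ t ∈ T, ∏ i, p (t i) := by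
    have : ∑ t : Fin m → W, ∏ i, p (t i) ≤ ∑ t : Fin m → W, ((if t ∈ T then ∏ i, p (t i) else 0) +
        ((if |∑ i, f₁ (t i) - m * ∑ a, p a * f₁ a| ≤ ε * m then 0 else ∏ i, p (t i)) +
        ((if |∑ i, f₂ (t i) - m * ∑ a, p a * f₂ a| ≤ ε * m then 0 else ∏ i, p (t i)) +
        (if |∑ i, -Real.log (p (t i)) - m * H| ≤ ε * m then 0 else ∏ i, p (t i))))) := by
      refine Finset.sum_le_sum fun t _ => ?_
      have hP : 0 ≤ ∏ i, p (t i) := Finset.prod_nonneg fun i _ => hp _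
      by_cases hpos : ∀ i, 0 < p (t i)
      · by_cases ht : t ∈ T
        · rw [if_pos ht]
          split_ifs <;> linarith
        · have : ¬ (|∑ i, f₁ (t i) - m * ∑ a, p a * f₁ a| ≤ ε * m ∧
            |∑ i, f₂ (t i) - m * ∑ a, p a * f₂ a| ≤ ε * m ∧
            |∑ i, -Real.log (p (t i)) - m * H| ≤ ε * m) := fun h =>
              ht (by simpa [hT] using ⟨hpos, by simpa using h⟩)
          split_ifs <;> first | linarith | (exfalso; tauto)
      · push Not at hpos
        obtain ⟨i, hi⟩ := hpos
        have h0 : ∏ i, p (t i) = 0 :=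
          Finset.prod_eq_zero (Finset.mem_univ i) (le_antisymm hi (hp _))
        simp [h0]
    rw [Finset.sum_add_distrib, Finset.sum_add_distrib, Finset.sum_add_distrib, htot,
      Finset.sum_ite_mem, Finset.univ_inter] at this
    linarith
  have hbound : ∀ t ∈ T, ∏ i, p (t i) ≤ Real.exp (-(m * (H - ε))) := by
    intro t ht
    obtain ⟨hpos, -, -, hl⟩ := (Finset.mem_filter.1 ht).2
    have : ∏ i, p (t i) = Real.exp (∑ i, Real.log (p (t i))) := by
      rw [Real.exp_sum]
      exact Finset.prod_congr rfl fun i _ => (Real.exp_log (hpos i)).symm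
    rw [this, Real.exp_le_exp]
    rw [Finset.sum_neg_distrib, abs_le] at hl
    linarith [hl.1]
  have h4 : ∑ t ∈ T, ∏ i, p (t i) ≤ T.card * Real.exp (-(m * (H - ε))) := by
    simpa using Finset.sum_le_card_nsmul T _ _ hbound
  rw [Real.exp_neg] at h4
  have h5 := hmass.trans h4
  rw [← div_eq_mul_inv, le_div_iff₀ (Real.exp_pos _)] at h5
  linarith

end Typical

section Birkhoff

lemma birkhoff_add {Y : Type*} (σ : Y → Y) (f : Y → ℝ) (m n : ℕ) (y : Y) :
    birkhoff σ f (m + n) y = birkhoff σ f m y + birkhoff σ f n (σ^[m] y) := by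
  simp only [birkhoff, Finset.sum_range_add]
  congr 1
  refine Finset.sum_congr rfl fun i _ => ?_
  rw [← Function.iterate_add_apply, add_comm]

lemma abs_birkhoff_le {Y : Type*} (σ : Y → Y) {f : Y → ℝ} {C : ℝ} (hC : ∀ y, |f y| ≤ C) (n : ℕ)
    (y : Y) : |birkhoff σ f n y| ≤ C * n := by
  refine (Finset.abs_sum_le_sum_abs _ _).trans ?_
  refine (Finset.sum_le_card_nsmul _ _ C fun i _ => hC _).trans ?_
  simp [mul_comm]

lemma birkhoff_sub_const {Y : Type*} (σ : Y → Y) (f : Y → ℝ) (a : ℝ) (n : ℕ) (y : Y) :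
    birkhoff σ (fun y => f y - a) n y = birkhoff σ f n y - n * a := by
  simp [birkhoff]

variable {A : Type} {X : Set (ℕ → A)}

lemma subShift_val (hX : MapsTo shift X X) (x : X) : (subShift X x).val = shift x.val := by
  rw [subShift, dif_pos (hX x.2)]

lemma iterate_subShift_val (hX : MapsTo shift X X) (n : ℕ) (x : X) (i : ℕ) :
    ((subShift X)^[n] x).val i = x.val (i + n) := by
  induction n generalizing x with
  | zero => rfl
  | succ n ih =>
    rw [Function.iterate_succ_apply, ih, subShift_val hX, shift]
    congr 1

lemma mem_cylinder_iff {w : List A} {x : ℕ → A} :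
    x ∈ cylinder w ↔ prefixWord x w.length = w := by
  constructor
  · intro h
    refine List.ext_get (by simp [prefixWord]) fun i h1 h2 => ?_
    simpa [prefixWord] using h ⟨i, h2⟩
  · intro h i
    have := List.ext_get_iff.1 h
    simpa [prefixWord] using this.2 i (by simp [prefixWord]) i.2

@[simp] lemma length_prefixWord (x : ℕ → A) (n : ℕ) : (prefixWord x n).length = n := by
  simp [prefixWord]

@[simp] lemma getElem_prefixWord (x : ℕ → A) (n i : ℕ) (h : i < (prefixWord x n).length) :
    (prefixWord x n)[i] = x i := by
  simp [prefixWord]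

lemma mem_cylinder_prefixWord (x : ℕ → A) (n : ℕ) : x ∈ cylinder (prefixWord x n) := by
  rw [mem_cylinder_iff, length_prefixWord]

lemma mem_cylinder_append {u v : List A} {x : ℕ → A} :
    x ∈ cylinder (u ++ v) ↔ x ∈ cylinder u ∧ (fun i => x (i + u.length)) ∈ cylinder v := by
  constructor
  · intro h
    refine ⟨fun i => ?_, fun i => ?_⟩
    · have := h ⟨i, by simp; omega⟩
      simpa using this
    · have := h ⟨i + u.length, by simp; omega⟩
      simpa using this
  · rintro ⟨h1, h2⟩ ⟨i, hi⟩
    by_cases hiu : i < u.length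
    · simpa [hiu] using h1 ⟨i, hiu⟩
    · push Not at hiu
      have := h2 ⟨i - u.length, by simp at hi; omega⟩
      simp only [Nat.sub_add_cancel hiu] at this
      simpa [List.getElem_append_right hiu] using this

variable [TopologicalSpace A]

lemma compactSpace_of_isClosed [Finite A] (hX : IsClosed X) : CompactSpace X :=
  isCompact_iff_compactSpace.1 hX.isCompact

lemma exists_abs_le [CompactSpace X] {f : X → ℝ} (hf : Continuous f) :
    ∃ C, 0 < C ∧ ∀ x, |f x| ≤ C := by
  obtain ⟨C, hC⟩ := (isCompact_range hf).isBounded.exists_norm_le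
  exact ⟨max C 1, by positivity, fun x => (hC _ ⟨x, rfl⟩).trans (le_max_left _ _)⟩

lemma continuous_subShift (hX : MapsTo shift X X) : Continuous (subShift X) := by
  rw [continuous_induced_rng]
  have : (Subtype.val ∘ subShift X) = fun x : X => shift x.val := funext (subShift_val hX)
  rw [this]
  exact continuous_pi fun i => (continuous_apply (i + 1)).comp continuous_subtype_val

variable [DiscreteTopology A]

lemma isOpen_cylinder (w : List A) : IsOpen (cylinder w) := by
  have : cylinder w = ⋂ i : Fin w.length, (fun x : ℕ → A => x i) ⁻¹' {w.get i} := by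
    ext x; simp [cylinder]
  rw [this]
  exact isOpen_iInter_of_finite fun i => (isOpen_discrete _).preimage (continuous_apply _)

lemma isClosed_cylinder (w : List A) : IsClosed (cylinder w) := by
  have : cylinder w = ⋂ i : Fin w.length, (fun x : ℕ → A => x i) ⁻¹' {w.get i} := by
    ext x; simp [cylinder]
  rw [this]
  exact isClosed_iInter fun i => (isClosed_discrete _).preimage (continuous_apply _)

lemma exists_coordinates [CompactSpace X] {f : X → ℝ} (hf : Continuous f) {ε : ℝ} (hε : 0 < ε) :
    ∃ r : ℕ, ∀ x y : X, (∀ i < r, x.val i = y.val i) → |f x - f y| ≤ ε := by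
  have loc : ∀ x : X, ∃ r : ℕ, ∀ y : X, (∀ i < r, y.val i = x.val i) → |f y - f x| < ε / 2 := by
    intro x
    have hU : IsOpen {y : X | |f y - f x| < ε / 2} := isOpen_lt (by fun_prop) continuous_const
    obtain ⟨V, hV, hVU⟩ := isOpen_induced_iff.1 hU
    have hxV : x.val ∈ V := by
      have : x ∈ Subtype.val ⁻¹' V := by rw [hVU]; simpa using half_pos hε
      exact this
    obtain ⟨_, ⟨z, n, rfl⟩, hxz, hzV⟩ :=
      (PiNat.isTopologicalBasis_cylinders fun _ => A).exists_subset_of_mem_open hxV hV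
    refine ⟨n, fun y hy => ?_⟩
    have : y ∈ Subtype.val ⁻¹' V := hzV fun i hi => (hy i hi).trans (hxz i hi)
    rwa [hVU] at this
  choose r hr using loc
  obtain ⟨t, -, ht⟩ := isCompact_univ.elim_nhds_subcover
    (fun x : X => Subtype.val ⁻¹' cylinder (prefixWord x.val (r x))) fun x _ =>
      ((isOpen_cylinder _).preimage continuous_subtype_val).mem_nhds
        (mem_cylinder_prefixWord x.val (r x))
  have hcyl : ∀ x z : X, x ∈ Subtype.val ⁻¹' cylinder (prefixWord z.val (r z)) →
      ∀ i < r z, x.val i = z.val i := by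
    intro x z h i hi
    simpa using h ⟨i, by simpa using hi⟩
  refine ⟨t.sup r, fun x y hxy => ?_⟩
  obtain ⟨z, hz, hxz⟩ := mem_iUnion₂.1 (ht (mem_univ x))
  have h1 := hr z x (hcyl x z hxz)
  have h2 := hr z y fun i hi =>
    (hxy i (hi.trans_le (Finset.le_sup hz))).symm.trans (hcyl x z hxz i hi)
  rw [abs_lt] at h1 h2
  rw [abs_le]
  constructor <;> linarith [h1.1, h1.2, h2.1, h2.2]

lemma exists_quasiAdd [CompactSpace X] (hX : MapsTo shift X X) {f : X → ℝ} (hf : Continuous f)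
    {ε : ℝ} (hε : 0 < ε) :
    ∃ (S : List A → ℝ) (K : ℝ), QuasiAdd S K ∧
      ∀ (x : X) (n : ℕ), |birkhoff (subShift X) f n x - S (prefixWord x.val n)| ≤ ε * n + K := by
  obtain ⟨C, hC0, hC⟩ := exists_abs_le hf
  obtain ⟨r, hr⟩ := exists_coordinates hf hε
  let F : List A → ℝ := fun l =>
    if h : ∃ x : X, prefixWord x.val r = l then f h.choose else 0
  have hFC : ∀ l, |F l| ≤ C := by
    intro l
    simp only [F]
    split_ifs
    · exact hC _
    · simpa using hC0.le
  have hFC₂ : ∀ l l', |F l - F l'| ≤ 2 * C := fun l l' =>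
    (abs_sub _ _).trans (by linarith [hFC l, hFC l'])
  have hFx : ∀ x : X, |f x - F (prefixWord x.val r)| ≤ ε := by
    intro x
    have h : ∃ y : X, prefixWord y.val r = prefixWord x.val r := ⟨x, rfl⟩
    simp only [F, dif_pos h]
    refine hr _ _ fun i hi => ?_
    have := List.ext_get_iff.1 h.choose_spec
    simpa using (this.2 i (by simpa using hi) (by simpa using hi)).symm
  let S : List A → ℝ := fun w => ∑ i ∈ Finset.range w.length, F ((w.drop i).take r)
  have few : ∀ (n : ℕ) (c : ℕ → ℝ) (D : ℝ), 0 ≤ D → (∀ i < n, i + r ≤ n → c i = 0) →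
      (∀ i < n, |c i| ≤ D) → |∑ i ∈ Finset.range n, c i| ≤ D * r := by
    intro n c D hD h0 hc
    have hsub : ∑ i ∈ Finset.range n, c i =
        ∑ i ∈ (Finset.range n).filter (fun i => n < i + r), c i := by
      rw [Finset.sum_filter]
      refine Finset.sum_congr rfl fun i hi => ?_
      split_ifs with h
      · rfl
      · exact h0 i (Finset.mem_range.1 hi) (by omega)
    rw [hsub]
    refine (Finset.abs_sum_le_sum_abs _ _).trans ?_
    refine (Finset.sum_le_card_nsmul _ _ D fun i hi =>
      hc i (Finset.mem_range.1 (Finset.mem_filter.1 hi).1)).trans ?_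
    have hcard : ((Finset.range n).filter (fun i => n < i + r)).card ≤ r := by
      calc _ ≤ (Finset.Ico (n - r) n).card := Finset.card_le_card fun i hi => by
            simp only [Finset.mem_filter, Finset.mem_range, Finset.mem_Ico] at hi ⊢; omega
        _ ≤ r := by simp; omega
    rw [nsmul_eq_mul, mul_comm]
    gcongr
  have happ : ∀ u v, |S (u ++ v) - S u - S v| ≤ 2 * C * r := by
    intro u v
    have : S (u ++ v) - S u - S v = ∑ i ∈ Finset.range u.length,
        (F (((u ++ v).drop i).take r) - F ((u.drop i).take r)) := by
      simp only [S, List.length_append, Finset.sum_range_add, Finset.sum_sub_distrib]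
      have : ∀ i, (u ++ v).drop (u.length + i) = v.drop i := by simp
      simp only [this]
      ring
    rw [this]
    refine few _ _ _ (by positivity) (fun i hi hir => ?_) fun i _ => ?_
    · rw [List.drop_append_of_le_length hi.le, List.take_append_of_le_length (by simp; omega),
        sub_self]
    · exact hFC₂ _ _
  have hr0 : (0 : ℝ) ≤ C * r := by positivity
  refine ⟨S, 2 * C * r + C, ⟨fun u v => (happ u v).trans (by linarith), fun a => ?_⟩, ?_⟩
  · simp only [S, List.length_singleton, Finset.range_one, Finset.sum_singleton]
    exact (hFC _).trans (by linarith)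
  intro x n
  have e : birkhoff (subShift X) f n x - S (prefixWord x.val n) = ∑ i ∈ Finset.range n,
      (f ((subShift X)^[i] x) - F (prefixWord ((subShift X)^[i] x).val r)) +
      ∑ i ∈ Finset.range n, (F (prefixWord ((subShift X)^[i] x).val r) -
        F (((prefixWord x.val n).drop i).take r)) := by
    simp only [birkhoff, S, length_prefixWord, Finset.sum_sub_distrib]; ring
  have h1 : |∑ i ∈ Finset.range n,
      (f ((subShift X)^[i] x) - F (prefixWord ((subShift X)^[i] x).val r))| ≤ ε * n := by
    refine (Finset.abs_sum_le_sum_abs _ _).trans ?_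
    refine (Finset.sum_le_card_nsmul _ _ ε fun i _ => hFx _).trans ?_
    simp [mul_comm]
  have h2 : |∑ i ∈ Finset.range n, (F (prefixWord ((subShift X)^[i] x).val r) -
        F (((prefixWord x.val n).drop i).take r))| ≤ 2 * C * r := by
    refine few _ _ _ (by positivity) (fun i hi hir => ?_) fun i _ => ?_
    · rw [sub_eq_zero]
      congr 1
      refine List.ext_getElem (by simp; omega) fun j h1 h2 => ?_
      simp [iterate_subShift_val hX, add_comm]
    · exact hFC₂ _ _
  rw [e]
  exact (abs_add_le _ _).trans (by linarith)

end Birkhoff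

section Words

variable {B : Type}

lemma exists_glued {L G : Set (List B)} {τ c : ℕ}
    (hspec : ∀ v ∈ G, ∀ w ∈ G, ∃ u ∈ L, u.length ≤ τ ∧ v ++ u ++ w ∈ G) :
    ∀ ws : List (List B), ws ≠ [] → (∀ w ∈ ws, ∃ v ∈ G, CommonSub c v w) →
      ∃ V ∈ G, CommonSub (ws.length * (c + τ)) V ws.flatten := by
  intro ws
  induction ws with
  | nil => intro h; exact absurd rfl h
  | cons w ws ih =>
    intro _ happ
    obtain ⟨v, hv, hvw⟩ := happ w (by simp)
    rcases eq_or_ne ws [] with rfl | hne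
    · exact ⟨v, hv, by simpa using hvw.mono (by omega)⟩
    · obtain ⟨V, hV, hVw⟩ := ih hne fun w' hw' => happ w' (by simp [hw'])
      obtain ⟨u, -, hu, hglue⟩ := hspec v hv V hV
      refine ⟨v ++ u ++ V, hglue, ?_⟩
      rw [List.append_assoc, List.flatten_cons]
      refine (hvw.append (hVw.append_left u)).mono ?_
      simp only [List.length_cons]
      rw [Nat.succ_mul]
      omega

end Words

section Invariant

variable {Y : Type*} [MeasurableSpace Y] {σ : Y → Y} {μ : ProbabilityMeasure Y}

lemma integral_comp_iterate (hσ : Measurable σ) (hμ : IsInvariant σ μ) {f : Y → ℝ}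
    (hf : Measurable f) (i : ℕ) :
    ∫ y, f (σ^[i] y) ∂μ.toMeasure = ∫ y, f y ∂μ.toMeasure := by
  induction i with
  | zero => rfl
  | succ i ih =>
    rw [← ih]
    have h : ∫ y, f (σ^[i] y) ∂(μ.toMeasure.map σ) = ∫ y, f (σ^[i] (σ y)) ∂μ.toMeasure :=
      integral_map hσ.aemeasurable
        (hf.comp (hσ.iterate i)).aestronglyMeasurable
    rw [hμ] at h
    simpa only [Function.iterate_succ_apply] using h.symm

lemma integrable_of_abs_le {f : Y → ℝ} (hf : Measurable f) {C : ℝ} (hC : ∀ y, |f y| ≤ C) :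
    Integrable f μ.toMeasure :=
  Integrable.of_bound hf.aestronglyMeasurable C (Eventually.of_forall hC)

lemma integral_birkhoff (hσ : Measurable σ) (hμ : IsInvariant σ μ) {f : Y → ℝ}
    (hf : Measurable f) {C : ℝ} (hC : ∀ y, |f y| ≤ C) (n : ℕ) :
    ∫ y, birkhoff σ f n y ∂μ.toMeasure = n * ∫ y, f y ∂μ.toMeasure := by
  simp only [birkhoff]
  rw [integral_finsetSum _ fun i _ => integrable_of_abs_le (f := fun y => f (σ^[i] y))
    (hf.comp (hσ.iterate i)) fun y => hC _]
  simp [integral_comp_iterate hσ hμ hf]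

end Invariant

section WordDistribution

variable {A : Type} {X : Set (ℕ → A)}

lemma cylF_eq_cylinder {n : ℕ} (w : Fin n → A) : cylF w = cylinder (List.ofFn w) := by
  ext x
  simp only [cylF, cylinder, mem_ofPred_eq, List.get_ofFn]
  constructor
  · intro h i
    simpa using h (i.cast (by simp))
  · intro h i
    simpa using h (i.cast (by simp))

/-- The initial word of length `n` as a function on `Fin n`. -/
def initWord (n : ℕ) (x : ℕ → A) : Fin n → A := fun i => x i

lemma preimage_initWord {n : ℕ} (w : Fin n → A) :
    (fun x : X => initWord n x.val) ⁻¹' {w} = Subtype.val ⁻¹' cylF w := by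
  ext x
  simp [cylF, initWord, funext_iff]

variable [MeasurableSpace A]

lemma measurable_initWord (n : ℕ) : Measurable (fun x : X => initWord n x.val) :=
  measurable_pi_lambda _ fun _ => (measurable_pi_apply _).comp measurable_subtype_coe

lemma ofFn_mem_language {μ : ProbabilityMeasure X} {n : ℕ} {w : Fin n → A}
    (h : 0 < (μ.toMeasure (Subtype.val ⁻¹' cylF w)).toReal) : List.ofFn w ∈ language X := by
  have hne : (Subtype.val ⁻¹' cylF w : Set X).Nonempty := by
    by_contra hcon
    rw [not_nonempty_iff_eq_empty] at hcon
    simp [hcon] at h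
  obtain ⟨x, hx⟩ := hne
  exact ⟨x, cylF_eq_cylinder w ▸ hx, x.2⟩

variable [Fintype A] [TopologicalSpace A] [DiscreteTopology A] [BorelSpace A]

lemma integral_initWord (μ : ProbabilityMeasure X) {n : ℕ} (F : (Fin n → A) → ℝ) :
    ∫ x, F (initWord n x.val) ∂μ.toMeasure =
      ∑ w, (μ.toMeasure (Subtype.val ⁻¹' cylF w)).toReal * F w := by
  have hm := measurable_initWord (X := X) n
  have := Measure.isProbabilityMeasure_map (μ := μ.toMeasure) hm.aemeasurable
  have h := integral_map (μ := μ.toMeasure) hm.aemeasurable (f := F)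
    (measurable_of_finite F).aestronglyMeasurable
  rw [← h, integral_fintype (Integrable.of_finite)]
  refine Finset.sum_congr rfl fun w _ => ?_
  rw [measureReal_def, Measure.map_apply hm (measurableSet_singleton w), preimage_initWord,
    smul_eq_mul]

lemma sum_cylF (μ : ProbabilityMeasure X) (n : ℕ) :
    ∑ w : Fin n → A, (μ.toMeasure (Subtype.val ⁻¹' cylF w)).toReal = 1 := by
  have := integral_initWord μ (n := n) fun _ => 1
  simpa using this.symm

lemma abs_sum_quasiAdd_le [CompactSpace X] (hX : MapsTo shift X X) {μ : ProbabilityMeasure X}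
    (hμ : IsInvariant (subShift X) μ) {f : X → ℝ} (hf : Continuous f) {S : List A → ℝ} {ε K : ℝ}
    (hS : ∀ (x : X) (n : ℕ),
      |birkhoff (subShift X) f n x - S (prefixWord x.val n)| ≤ ε * n + K) (n : ℕ) :
    |∑ w : Fin n → A, (μ.toMeasure (Subtype.val ⁻¹' cylF w)).toReal * S (List.ofFn w) -
      n * ∫ x, f x ∂μ.toMeasure| ≤ ε * n + K := by
  obtain ⟨C, -, hC⟩ := exists_abs_le hf
  have hσ := (continuous_subShift hX).measurable
  have hbm : Measurable (birkhoff (subShift X) f n) := by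
    unfold birkhoff
    exact Finset.measurable_fun_sum _ fun i _ => hf.measurable.comp (hσ.iterate i)
  have hbi : Integrable (birkhoff (subShift X) f n) μ.toMeasure :=
    integrable_of_abs_le hbm (abs_birkhoff_le _ hC n)
  have hSi : Integrable (fun x : X => S (List.ofFn (initWord n x.val))) μ.toMeasure := by
    have : Measurable fun x : X => S (List.ofFn (initWord n x.val)) :=
      (measurable_of_finite fun w : Fin n → A => S (List.ofFn w)).comp (measurable_initWord n)
    obtain ⟨D, hD⟩ := (Set.finite_range fun w : Fin n → A => |S (List.ofFn w)|).bddAbove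
    exact integrable_of_abs_le this fun x => hD ⟨_, rfl⟩
  rw [← integral_birkhoff hσ hμ hf.measurable hC, ← integral_initWord μ fun w => S (List.ofFn w),
    ← integral_sub hSi hbi]
  have := norm_integral_le_of_norm_le_const (μ := μ.toMeasure)
    (f := fun x : X => S (List.ofFn (initWord n x.val)) - birkhoff (subShift X) f n x)
    (C := ε * n + K) (Eventually.of_forall fun x => by
      rw [Real.norm_eq_abs, abs_sub_comm]; exact hS x n)
  simpa using this

end WordDistribution

section Blocks

lemma QuasiAdd.mono {B : Type} {S : List B → ℝ} {K K' : ℝ} (h : QuasiAdd S K) (hK : K ≤ K') :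
    QuasiAdd S K' :=
  ⟨fun u v => (h.append u v).trans hK, fun a => (h.single a).trans hK⟩

variable {A : Type} {X : Set (ℕ → A)}

lemma birkhoff_glued_le {f : X → ℝ} {S : List A → ℝ} {η K a E : ℝ} (hS : QuasiAdd S K)
    (hSf : ∀ (x : X) (n : ℕ),
      |birkhoff (subShift X) f n x - S (prefixWord x.val n)| ≤ η * n + K)
    {n m k : ℕ} (hm : 1 ≤ m) (hη : 0 ≤ η) (hK : K ≤ η * n) {t : Fin m → Fin n → A}
    (ht : |∑ i, S (List.ofFn (t i)) - m * E| ≤ η * m) (hn : 1 ≤ n)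
    (hE : |E - n * a| ≤ η * n + K) {V : List A}
    (hV : CommonSub k V (List.ofFn fun i => List.ofFn (t i)).flatten)
    (hk : K * k ≤ η * (m * n)) (hVM : |(V.length : ℝ) - m * n| ≤ η * (m * n))
    (hV2 : (V.length : ℝ) ≤ 2 * (m * n)) {x : X} (hx : x.val ∈ cylinder V) :
    |birkhoff (subShift X) f V.length x - V.length * a| ≤ (18 + |a|) * η * (m * n) := by
  have hm' : (1 : ℝ) ≤ m := by exact_mod_cast hm
  have hn' : (1 : ℝ) ≤ n := by exact_mod_cast hn
  have h1 := hSf x V.length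
  rw [mem_cylinder_iff.1 hx] at h1
  have h2 := hS.commonSub hV
  have h3 := hS.flatten (List.ofFn fun i => List.ofFn (t i))
  rw [List.length_ofFn, List.map_ofFn, List.sum_ofFn] at h3
  simp only [Function.comp_apply] at h3
  have hKM : K ≤ η * (m * n) := hK.trans (by gcongr; nlinarith)
  have hKm : K * (m + 1) ≤ 2 * η * (m * n) := by
    have : K * m ≤ η * n * m := by gcongr
    nlinarith
  have h4 : |m * E - m * n * a| ≤ 2 * η * (m * n) := by
    have : m * E - m * n * a = m * (E - n * a) := by ring
    rw [this, abs_mul, abs_of_nonneg (by positivity)]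
    nlinarith
  have h5 : |m * n * a - V.length * a| ≤ |a| * (η * (m * n)) := by
    rw [← sub_mul, abs_mul, mul_comm, abs_sub_comm]
    gcongr
  have h6 : η * m ≤ η * (m * n) := by gcongr; nlinarith
  have h7 : η * V.length ≤ η * (2 * (m * n)) := by gcongr
  have h8 := ht.trans h6
  have h9 := h3.trans hKm
  have h10 : |S V - S (List.ofFn fun i => List.ofFn (t i)).flatten| ≤ 10 * (η * (m * n)) :=
    h2.trans (by linarith)
  have h11 : |birkhoff (subShift X) f V.length x - S V| ≤ 3 * (η * (m * n)) :=
    h1.trans (by linarith)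
  rw [abs_le] at h4 h5 h8 h9 h10 h11 ⊢
  constructor <;>
  linarith [h4.1, h5.1, h8.1, h9.1, h10.1, h11.1, h4.2, h5.2, h8.2, h9.2, h10.2, h11.2]

lemma ofFn_flatten_injective {B : Type} (m n : ℕ) :
    Function.Injective fun t : Fin m → Fin n → B =>
      (List.ofFn fun i => List.ofFn (t i)).flatten := by
  intro t t' h
  have : (List.ofFn fun i => List.ofFn (t i)) = List.ofFn fun i => List.ofFn (t' i) := by
    rw [List.eq_iff_flatten_eq]
    refine ⟨h, ?_⟩
    simp [List.map_ofFn, Function.comp_def]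
  exact funext fun i => List.ofFn_injective (congrFun (List.ofFn_injective this) i)

lemma length_ofFn_flatten {B : Type} {m n : ℕ} (t : Fin m → Fin n → B) :
    (List.ofFn fun i => List.ofFn (t i)).flatten.length = m * n := by
  simp [List.length_flatten, List.map_ofFn, Function.comp_def]

lemma exists_fiber_card_ge {ι B : Type} [Fintype B] {M k : ℕ} {T : Finset ι} {W V : ι → List B}
    (hW : Function.Injective W) (hWl : ∀ t ∈ T, (W t).length = M)
    (hV : ∀ t ∈ T, CommonSub k (V t) (W t)) (hk : k ≤ M) {z : ℝ} (hz : 0 < z) (hz1 : z ≤ 1) :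
    ∃ (N : ℕ) (T' : Finset ι), T' ⊆ T ∧ (∀ t ∈ T', (V t).length = N) ∧ N ≤ M + k ∧ M ≤ N + k ∧
      (T.card : ℝ) * z ^ (2 * k) ≤
        (2 * k + 1) * ((T'.image V).card * ((1 + z) ^ N * (1 + Fintype.card B * z) ^ M)) := by
  have hcard : (Finset.Icc (M - k) (M + k)).card = 2 * k + 1 := by
    rw [Nat.card_Icc]; omega
  obtain ⟨N, hN, hcardN⟩ := Finset.exists_le_card_fiber_of_nsmul_le_card_of_maps_to
    (s := T) (t := Finset.Icc (M - k) (M + k)) (f := fun t => (V t).length)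
    (b := (T.card : ℝ) / (2 * k + 1)) (fun t ht => by
      have := (hV t ht).length_le
      have := hWl t ht
      rw [Finset.mem_Icc]; omega) ⟨M, by rw [Finset.mem_Icc]; omega⟩ (by
      rw [hcard, nsmul_eq_mul]
      push_cast
      rw [mul_div_cancel₀ _ (by positivity)])
  rw [Finset.mem_Icc] at hN
  refine ⟨N, T.filter fun t => (V t).length = N, Finset.filter_subset _ _,
    fun t ht => (Finset.mem_filter.1 ht).2, hN.2, by omega, ?_⟩
  set T' := T.filter fun t => (V t).length = N
  have hfib : ∀ d ∈ T'.image V, ((T'.filter fun t => V t = d).card : ℝ) * z ^ (2 * k) ≤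
      (1 + z) ^ N * (1 + Fintype.card B * z) ^ M := by
    intro d hd
    obtain ⟨t₀, ht₀, rfl⟩ := Finset.mem_image.1 hd
    rw [← Finset.card_image_of_injective (T'.filter fun t => V t = V t₀) hW]
    have hN' : (V t₀).length = N := (Finset.mem_filter.1 ht₀).2
    rw [← hN']
    refine card_commonSub_le _ _ (fun w hw => ?_) hz hz1
    obtain ⟨t, ht, rfl⟩ := Finset.mem_image.1 hw
    obtain ⟨ht', hVt⟩ := Finset.mem_filter.1 ht
    have htT := (Finset.mem_filter.1 ht').1
    exact ⟨hWl t htT, hVt ▸ hV t htT⟩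
  have hsum : (T'.card : ℝ) * z ^ (2 * k) ≤
      (T'.image V).card * ((1 + z) ^ N * (1 + Fintype.card B * z) ^ M) := by
    rw [Finset.card_eq_sum_card_image V T']
    push_cast
    rw [Finset.sum_mul]
    refine (Finset.sum_le_sum hfib).trans ?_
    rw [Finset.sum_const, nsmul_eq_mul]
  rw [div_le_iff₀ (by positivity)] at hcardN
  calc (T.card : ℝ) * z ^ (2 * k) ≤ (T'.card * (2 * k + 1)) * z ^ (2 * k) := by gcongr
    _ = (2 * k + 1) * (T'.card * z ^ (2 * k)) := by ring
    _ ≤ _ := by gcongr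

end Blocks

section GoodBlocks

lemma exp_le_card_of_fiber_bound {M N k : ℕ} {c t a z η h : ℝ} (hc : 0 ≤ c) (ha : 0 ≤ a)
    (hη : 0 < η)
    (hz : z = η / (1 + a)) (ht : Real.exp (M * h - η * M) / 2 ≤ t)
    (hzk : -Real.log z * k ≤ η * M) (hk : 2 * (2 * (k : ℝ) + 1) ≤ Real.exp (η * M))
    (hN : (N : ℝ) ≤ 2 * M)
    (hcard : t * z ^ (2 * k) ≤ (2 * k + 1) * (c * ((1 + z) ^ N * (1 + a * z) ^ M))) :
    Real.exp (M * h - 6 * η * M) ≤ c := by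
  have hz0 : 0 < z := by rw [hz]; positivity
  have hza : (2 + a) * z ≤ 2 * η := by
    rw [hz, mul_div_assoc', div_le_iff₀ (by positivity)]
    nlinarith
  have h1 : Real.exp (-(2 * η * M)) ≤ z ^ (2 * k) := by
    rw [← Real.exp_log hz0, ← Real.exp_nat_mul, Real.exp_le_exp]
    push_cast
    linarith
  have h2 : (1 + z) ^ N * (1 + a * z) ^ M ≤ Real.exp (2 * η * M) := by
    have e1 : (1 + z) ^ N ≤ Real.exp (N * z) := by
      rw [Real.exp_nat_mul]
      gcongr
      linarith [Real.add_one_le_exp z]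
    have e2 : (1 + a * z) ^ M ≤ Real.exp (M * (a * z)) := by
      rw [Real.exp_nat_mul]
      gcongr
      linarith [Real.add_one_le_exp (a * z)]
    calc (1 + z) ^ N * (1 + a * z) ^ M ≤ Real.exp (N * z) * Real.exp (M * (a * z)) := by gcongr
      _ = Real.exp (N * z + M * (a * z)) := by rw [Real.exp_add]
      _ ≤ _ := by
        rw [Real.exp_le_exp]
        have : (N : ℝ) * z ≤ 2 * M * z := by gcongr
        have h3 : (M : ℝ) * ((2 + a) * z) ≤ M * (2 * η) := by gcongr
        nlinarith
  have h3 : Real.exp (M * h - η * M) * Real.exp (-(2 * η * M)) ≤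
      Real.exp (η * M) * (c * Real.exp (2 * η * M)) := by
    calc Real.exp (M * h - η * M) * Real.exp (-(2 * η * M))
        = 2 * (Real.exp (M * h - η * M) / 2 * Real.exp (-(2 * η * M))) := by ring
      _ ≤ 2 * (t * z ^ (2 * k)) := by
        have : 0 ≤ t := le_trans (by positivity) ht
        gcongr
      _ ≤ 2 * ((2 * k + 1) * (c * ((1 + z) ^ N * (1 + a * z) ^ M))) := by gcongr
      _ = (2 * (2 * k + 1)) * (c * ((1 + z) ^ N * (1 + a * z) ^ M)) := by ring
      _ ≤ _ := by gcongr
  have h4 : Real.exp (M * h - 6 * η * M) * (Real.exp (η * M) * Real.exp (2 * η * M)) ≤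
      c * (Real.exp (η * M) * Real.exp (2 * η * M)) := by
    calc Real.exp (M * h - 6 * η * M) * (Real.exp (η * M) * Real.exp (2 * η * M))
        = Real.exp (M * h - η * M + -(2 * η * M)) := by
          rw [← Real.exp_add, ← Real.exp_add]; ring_nf
      _ ≤ Real.exp (η * M) * (c * Real.exp (2 * η * M)) := by rw [Real.exp_add]; exact h3
      _ = _ := by ring
  exact le_of_mul_le_mul_right h4 (by positivity)

variable {A : Type} {X : Set (ℕ → A)} [Fintype A] [MeasurableSpace A]

lemma wordEntropy_nonneg (μ : ProbabilityMeasure X) (n : ℕ) : 0 ≤ wordEntropy X μ n :=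
  Finset.sum_nonneg fun _ _ => Real.negMulLog_nonneg ENNReal.toReal_nonneg (by
    rw [← measureReal_def]; exact measureReal_le_one)

lemma entropy_nonneg (μ : ProbabilityMeasure X) : 0 ≤ entropy X μ :=
  le_ciInf fun n => div_nonneg (wordEntropy_nonneg μ _) (by positivity)

lemma mul_entropy_le (μ : ProbabilityMeasure X) {n : ℕ} (hn : 1 ≤ n) :
    n * entropy X μ ≤ wordEntropy X μ n := by
  obtain ⟨n, rfl⟩ : ∃ k, n = k + 1 := ⟨n - 1, by omega⟩
  have hb : BddBelow (range fun n : ℕ => wordEntropy X μ (n + 1) / (n + 1)) :=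
    ⟨0, by rintro _ ⟨n, rfl⟩; exact div_nonneg (wordEntropy_nonneg μ _) (by positivity)⟩
  have := ciInf_le hb n
  rw [le_div_iff₀ (by positivity)] at this
  rw [mul_comm]
  push_cast
  exact this

variable [TopologicalSpace A] [DiscreteTopology A] [BorelSpace A]

theorem exists_block [CompactSpace X] (hX : MapsTo shift X X) {G : Set (List A)}
    (hspec : HasSpecW (language X) G) (happ : EditApproachable (language X) G)
    {μ : ProbabilityMeasure X} (hμ : IsInvariant (subShift X) μ) {φ ψ : X → ℝ}
    (hφ : Continuous φ) (hψ : Continuous ψ) {δ : ℝ} (hδ : 0 < δ) :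
    ∃ (N : ℕ) (D : Finset (List A)), 1 ≤ δ * N ∧
      (∀ d ∈ D, d ∈ G ∧ d.length = N ∧ ∀ x : X, x.val ∈ cylinder d →
        |birkhoff (subShift X) φ N x - N * ∫ y, φ y ∂μ.toMeasure| ≤ δ * N ∧
        |birkhoff (subShift X) ψ N x - N * ∫ y, ψ y ∂μ.toMeasure| ≤ δ * N) ∧
      Real.exp (N * (entropy X μ - δ)) ≤ D.card := by
  obtain ⟨τ, hspec⟩ := hspec
  obtain ⟨g, ⟨-, hg⟩, happ⟩ := happ
  set a₁ := ∫ y, φ y ∂μ.toMeasure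
  set a₂ := ∫ y, ψ y ∂μ.toMeasure
  set h := entropy X μ
  set c : ℝ := 1 + |a₁| + |a₂| + |h|
  have hc1 : 1 ≤ c := by
    have := abs_nonneg a₁; have := abs_nonneg a₂; have := abs_nonneg h
    simp only [c]; linarith
  obtain ⟨η, hη, hη2, hηδ⟩ : ∃ η : ℝ, 0 < η ∧ η ≤ 1 / 2 ∧ 100 * c * η ≤ δ := by
    refine ⟨min (1 / 2) (δ / (100 * c)), by positivity, min_le_left _ _, ?_⟩
    have := min_le_right (1 / 2 : ℝ) (δ / (100 * c))
    rw [le_div_iff₀ (by positivity)] at this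
    linarith
  obtain ⟨S₁, K₁, hS₁, hSf₁⟩ := exists_quasiAdd hX hφ hη
  obtain ⟨S₂, K₂, hS₂, hSf₂⟩ := exists_quasiAdd hX hψ hη
  set K := max 1 (max K₁ K₂)
  have hK1 : 1 ≤ K := le_max_left _ _
  have hK₁ : K₁ ≤ K := (le_max_left _ _).trans (le_max_right _ _)
  have hK₂ : K₂ ≤ K := (le_max_right _ _).trans (le_max_right _ _)
  replace hS₁ := hS₁.mono hK₁
  replace hS₂ := hS₂.mono hK₂
  replace hSf₁ := fun x n => (hSf₁ x n).trans (add_le_add_right hK₁ (η * n))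
  replace hSf₂ := fun x n => (hSf₂ x n).trans (add_le_add_right hK₂ (η * n))
  set a : ℝ := (Fintype.card A : ℝ)
  have ha : 0 ≤ a := Nat.cast_nonneg _
  set z := η / (1 + a) with hz
  have hz0 : 0 < z := by positivity
  have hz1 : z ≤ 1 := by
    rw [hz, div_le_one (by positivity)]; linarith
  have hlz : 0 ≤ -Real.log z := by
    have := Real.log_nonpos hz0.le hz1; linarith
  obtain ⟨n, hn1, hnK, hnδ, hnq⟩ : ∃ n : ℕ, 1 ≤ n ∧ K ≤ η * n ∧ 2 ≤ δ * n ∧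
      (K + -Real.log z + 1) * (g n + τ : ℕ) ≤ η * n := by
    have l1 : Tendsto (fun n : ℕ => (n : ℝ)) atTop atTop := tendsto_natCast_atTop_atTop
    have l2 : Tendsto (fun n : ℕ => (K + -Real.log z + 1) * ((g n : ℝ) / n + τ / n)) atTop
        (𝓝 ((K + -Real.log z + 1) * (0 + 0))) :=
      (hg.add (tendsto_const_nhds.div_atTop l1)).const_mul _
    rw [add_zero, mul_zero] at l2
    have := (eventually_ge_atTop 1).and <| ((l1.const_mul_atTop hη).eventually_ge_atTop K).and <|
      ((l1.const_mul_atTop hδ).eventually_ge_atTop 2).and <| l2.eventually (ge_mem_nhds hη)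
    obtain ⟨n, h1, h2, h3, h4⟩ := this.exists
    refine ⟨n, h1, h2, h3, ?_⟩
    have hn0 : (0 : ℝ) < n := by exact_mod_cast h1
    rw [← add_div, mul_div_assoc', div_le_iff₀ hn0] at h4
    push_cast
    exact h4
  set q := g n + τ
  have hn1' : (1 : ℝ) ≤ n := by exact_mod_cast hn1
  set p : (Fin n → A) → ℝ := fun w => (μ.toMeasure (Subtype.val ⁻¹' cylF w)).toReal
  have hev := exists_typical (p := p) (fun w => ENNReal.toReal_nonneg) (sum_cylF μ n)
    (fun w => S₁ (List.ofFn w)) (fun w => S₂ (List.ofFn w)) hη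
  obtain ⟨m, ⟨T, hT, hTcard⟩, hm1, hm2⟩ := (hev.and ((eventually_ge_atTop 1).and
    ((tendsto_natCast_atTop_atTop (R := ℝ)).eventually_ge_atTop (12 / η)))).exists
  have hm1' : (1 : ℝ) ≤ m := by exact_mod_cast hm1
  have hmn : ((m * n : ℕ) : ℝ) = m * n := by push_cast; ring
  set k := m * q
  have hkq : (k : ℝ) = m * q := by simp only [k]; push_cast; ring
  have hq0 : (0 : ℝ) ≤ q := Nat.cast_nonneg _
  have hKq : K * q ≤ η * n := by nlinarith only [hnq, hq0, hlz]
  have hLq : -Real.log z * q ≤ η * n := by nlinarith only [hnq, hq0, hK1]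
  have hqn : (q : ℝ) ≤ η * n := by nlinarith only [hnq, hq0, hlz, hK1]
  have hKk : K * k ≤ η * (m * n) := by
    rw [hkq]; have : m * (K * q) ≤ m * (η * n) := by gcongr
    linarith
  have hLk : -Real.log z * k ≤ η * (m * n) := by
    rw [hkq]; have : m * (-Real.log z * q) ≤ m * (η * n) := by gcongr
    linarith
  have hkn : (k : ℝ) ≤ η * (m * n) := by
    rw [hkq]; have : m * (q : ℝ) ≤ m * (η * n) := by gcongr
    linarith
  have hVex : ∀ t : Fin m → Fin n → A, ∃ V, t ∈ T → V ∈ G ∧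
      CommonSub k V (List.ofFn fun i => List.ofFn (t i)).flatten := by
    intro t
    by_cases ht : t ∈ T
    · obtain ⟨V, hV, hVc⟩ := exists_glued (c := g n) hspec (List.ofFn fun i => List.ofFn (t i))
        (by rw [Ne, ← List.length_eq_zero_iff, List.length_ofFn]; omega) (by
          intro w hw
          obtain ⟨i, rfl⟩ := (List.mem_ofFn' _ _).1 hw
          obtain ⟨v, hv, hvw⟩ := happ _ (ofFn_mem_language ((hT t ht).1 i))
          rw [List.length_ofFn] at hvw
          exact ⟨v, hv, commonSub_of_editDist_le hvw⟩)
      rw [List.length_ofFn] at hVc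
      exact ⟨V, fun _ => ⟨hV, hVc⟩⟩
    · exact ⟨[], fun h => absurd h ht⟩
  choose V hV using hVex
  have hkM : k ≤ m * n := by
    have : (k : ℝ) ≤ (m * n : ℕ) := by
      rw [hmn]
      nlinarith only [hkn, hη2, hm1', hn1',
        mul_nonneg (zero_le_one.trans hm1') (zero_le_one.trans hn1')]
    exact_mod_cast this
  obtain ⟨N, T', hT', hT'N, hN1, hN2, hcard⟩ := exists_fiber_card_ge (M := m * n) (k := k)
    (ofFn_flatten_injective m n) (fun t _ => length_ofFn_flatten t) (fun t ht => (hV t ht).2)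
    hkM hz0 hz1
  have hN1' : (N : ℝ) ≤ m * n + k := by rw [← hmn]; exact_mod_cast hN1
  have hN2' : (m * n : ℝ) ≤ N + k := by rw [← hmn]; exact_mod_cast hN2
  have hmn0 : (1 : ℝ) ≤ m * n := by nlinarith only [hm1', hn1']
  have hηmn : η * (m * n : ℝ) ≤ m * n / 2 := by nlinarith only [hmn0, hη2]
  have hNM : |(N : ℝ) - m * n| ≤ η * (m * n) := by
    rw [abs_le]; constructor <;> linarith
  have hNhalf : (m * n : ℝ) ≤ 2 * N := by linarith
  have hbound : ∀ b : ℝ, |b| ≤ c → (18 + |b|) * η * (m * n) ≤ δ * N := by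
    intro b hb
    have h1 : (18 + |b|) * η ≤ 50 * c * η := by gcongr; linarith
    have h2 : (18 + |b|) * η * (m * n) ≤ δ / 2 * (m * n) := by gcongr; linarith
    nlinarith only [h2, hNhalf, hδ]
  have hE : ∀ t ∈ T', t ∈ T := fun t ht => hT' ht
  have hδN : 1 ≤ δ * N := by
    have h1 : δ * n ≤ δ * (m * n) := by gcongr; nlinarith only [hm1', hn1']
    have h2 : δ * (m * n : ℝ) ≤ δ * (2 * N) := by gcongr
    linarith only [h1, h2, hnδ]
  refine ⟨N, T'.image V, hδN, ?_, ?_⟩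
  · intro d hd
    obtain ⟨t, ht, rfl⟩ := Finset.mem_image.1 hd
    refine ⟨(hV t (hE t ht)).1, hT'N t ht, fun x hx => ?_⟩
    rw [← hT'N t ht] at hNM hNhalf hN1' ⊢
    have hb₁ := hbound a₁ (by simp only [c]; linarith [abs_nonneg a₂, abs_nonneg h])
    have hb₂ := hbound a₂ (by simp only [c]; linarith [abs_nonneg a₁, abs_nonneg h])
    rw [← hT'N t ht] at hb₁ hb₂
    constructor
    · exact (birkhoff_glued_le hS₁ hSf₁ hm1 hη.le hnK (hT t (hE t ht)).2.1 hn1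
        (abs_sum_quasiAdd_le hX hμ hφ hSf₁ n) (hV t (hE t ht)).2 hKk hNM (by linarith) hx).trans hb₁
    · exact (birkhoff_glued_le hS₂ hSf₂ hm1 hη.le hnK (hT t (hE t ht)).2.2 hn1
        (abs_sum_quasiAdd_le hX hμ hψ hSf₂ n) (hV t (hE t ht)).2 hKk hNM (by linarith) hx).trans hb₂
  · have hbig := exp_le_card_of_fiber_bound (M := m * n) (h := h) (Nat.cast_nonneg _) ha hη hz
      (t := T.card) (c := (T'.image V).card) (N := N) (k := k) ?_ (by rw [hmn]; exact hLk) ?_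
      (by rw [hmn]; linarith) hcard
    · refine le_trans ?_ hbig
      rw [Real.exp_le_exp, hmn]
      have h1 : (N - m * n : ℝ) * h ≤ η * (m * n) * |h| := by
        refine (le_abs_self _).trans ?_
        rw [abs_mul]
        gcongr
      have h2 : η * (m * n) * |h| + 6 * η * (m * n) ≤ δ / 2 * (m * n) := by
        have : (6 + |h|) * η ≤ 50 * c * η := by
          gcongr; simp only [c]; linarith [abs_nonneg a₁, abs_nonneg a₂]
        have : (6 + |h|) * η * (m * n) ≤ δ / 2 * (m * n) := by gcongr; linarith
        linarith
      nlinarith only [h1, h2, hNhalf, hδ]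
    · refine le_trans ?_ hTcard
      gcongr
      rw [hmn]
      have h1 : (n : ℝ) * h ≤ ∑ w, Real.negMulLog (p w) := mul_entropy_le μ hn1
      have h2 : (m : ℝ) * (n * h) ≤ m * ∑ w, Real.negMulLog (p w) := by gcongr
      have h3 : η * (m : ℝ) ≤ η * (m * n) := by gcongr; nlinarith only [hm1', hn1']
      linarith only [h2, h3]
    · rw [hmn]
      have h0 : 12 ≤ η * (m * n : ℝ) := by
        rw [div_le_iff₀ hη] at hm2
        have : η * (m : ℝ) ≤ η * (m * n) := by gcongr; nlinarith only [hm1', hn1']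
        linarith only [this, hm2]
      have := Real.quadratic_le_exp_of_nonneg (x := η * (m * n : ℝ)) (by positivity)
      nlinarith only [this, h0, hkn]

end GoodBlocks

section SlowSequences

lemma exists_slow_sequence (a : ℕ → ℕ) : ∃ j : ℕ → ℕ, Tendsto j atTop atTop ∧
    ∀ ε : ℝ, 0 < ε → ∃ C : ℝ, ∀ i, (a (j i) : ℝ) ≤ ε * i + C := by
  set j : ℕ → ℕ := fun i => Nat.findGreatest (fun l => l * a l ≤ i) i
  have hj1 : ∀ i, j i * a (j i) ≤ i := fun i =>
    Nat.findGreatest_spec (P := fun l => l * a l ≤ i) (Nat.zero_le i) (by simp)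
  have hj2 : Tendsto j atTop atTop := by
    refine tendsto_atTop.2 fun l => ?_
    filter_upwards [eventually_ge_atTop (max l (l * a l))] with i hi
    exact Nat.le_findGreatest ((le_max_left _ _).trans hi) ((le_max_right _ _).trans hi)
  refine ⟨j, hj2, fun ε hε => ?_⟩
  obtain ⟨l, hl⟩ := exists_nat_gt (1 / ε)
  obtain ⟨i₀, hi₀⟩ := eventually_atTop.1 (tendsto_atTop.1 hj2 l)
  refine ⟨∑ i ∈ Finset.range i₀, (a (j i) : ℝ), fun i => ?_⟩
  have hs : 0 ≤ ∑ i ∈ Finset.range i₀, (a (j i) : ℝ) := Finset.sum_nonneg fun _ _ => by positivity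
  rcases lt_or_ge i i₀ with h | h
  · have := Finset.single_le_sum (f := fun i => (a (j i) : ℝ)) (fun _ _ => by positivity)
      (Finset.mem_range.2 h)
    have : 0 ≤ ε * (i : ℝ) := by positivity
    linarith
  · have h1 : (l : ℝ) * a (j i) ≤ i := by
      exact_mod_cast (Nat.mul_le_mul_right _ (hi₀ i h)).trans (hj1 i)
    rw [div_lt_iff₀ hε] at hl
    have h2 : (a (j i) : ℝ) ≤ l * ε * a (j i) := le_mul_of_one_le_left (by positivity) hl.le
    have h3 : ε * (l * a (j i) : ℝ) ≤ ε * i := by gcongr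
    linarith

lemma exists_sum_mul_le {e b : ℕ → ℝ} (he : Tendsto e atTop (𝓝 0)) (hb : ∀ i, 0 ≤ b i) {ε : ℝ}
    (hε : 0 < ε) :
    ∃ C : ℝ, ∀ k, ∑ i ∈ Finset.range k, e i * b i ≤ ε * ∑ i ∈ Finset.range k, b i + C := by
  obtain ⟨i₀, hi₀⟩ := eventually_atTop.1 (he.eventually (ge_mem_nhds hε))
  refine ⟨∑ i ∈ Finset.range i₀, |e i * b i|, fun k => ?_⟩
  have hC : 0 ≤ ∑ i ∈ Finset.range i₀, |e i * b i| := Finset.sum_nonneg fun _ _ => abs_nonneg _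
  rw [Finset.mul_sum, ← sub_le_iff_le_add', ← Finset.sum_sub_distrib]
  have h1 : ∑ i ∈ Finset.range k, (e i * b i - ε * b i) ≤
      ∑ i ∈ Finset.range k, if i < i₀ then |e i * b i| else 0 := by
    refine Finset.sum_le_sum fun i _ => ?_
    split_ifs with h
    · have := le_abs_self (e i * b i)
      have := mul_nonneg hε.le (hb i)
      linarith
    · have := mul_le_mul_of_nonneg_right (hi₀ i (not_lt.1 h)) (hb i)
      linarith
  refine h1.trans ?_
  rw [← Finset.sum_filter]
  refine Finset.sum_le_sum_of_subset_of_nonneg (fun i hi => ?_) fun _ _ _ => abs_nonneg _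
  exact Finset.mem_range.2 (Finset.mem_filter.1 hi).2

variable {A : Type} {X : Set (ℕ → A)} [Fintype A] [MeasurableSpace A]
  [TopologicalSpace A] [DiscreteTopology A] [BorelSpace A]

theorem exists_block_sequence [CompactSpace X] (hX : MapsTo shift X X) {G : Set (List A)}
    (hspec : HasSpecW (language X) G) (happ : EditApproachable (language X) G)
    {μ : ProbabilityMeasure X} (hμ : IsInvariant (subShift X) μ) {φ ψ : X → ℝ}
    (hφ : Continuous φ) (hψ : Continuous ψ) :
    ∃ (N : ℕ → ℕ) (D : ℕ → Finset (List A)) (e : ℕ → ℝ), (∀ i, 1 ≤ e i * N i) ∧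
      (∀ ε : ℝ, 0 < ε → ∃ C : ℝ, ∀ i, (N i : ℝ) ≤ ε * i + C) ∧
      (∀ ε : ℝ, 0 < ε → ∃ C : ℝ, ∀ k, ∑ i ∈ Finset.range k, e i * N i ≤
        ε * ∑ i ∈ Finset.range k, (N i : ℝ) + C) ∧
      (∀ i, ∀ d ∈ D i, d ∈ G ∧ d.length = N i ∧ ∀ x : X, x.val ∈ cylinder d →
        |birkhoff (subShift X) φ (N i) x - N i * ∫ y, φ y ∂μ.toMeasure| ≤ e i * N i ∧
        |birkhoff (subShift X) ψ (N i) x - N i * ∫ y, ψ y ∂μ.toMeasure| ≤ e i * N i) ∧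
      ∀ i, Real.exp (N i * (entropy X μ - e i)) ≤ (D i).card := by
  have hblock := fun j : ℕ => exists_block hX hspec happ hμ hφ hψ (Nat.one_div_pos_of_nat (n := j))
  choose N D h1 h2 h3 using hblock
  obtain ⟨j, hj, hN⟩ := exists_slow_sequence N
  refine ⟨fun i => N (j i), fun i => D (j i), fun i => 1 / ((j i : ℝ) + 1), fun i => h1 (j i), hN,
    fun ε hε => exists_sum_mul_le ?_ (fun _ => by positivity) hε, fun i => h2 (j i),
    fun i => h3 (j i)⟩
  exact tendsto_one_div_add_atTop_nhds_zero_nat.comp hj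

end SlowSequences

section Concatenations

lemma exists_uniform_product (W : ℕ → Type) [∀ i, Fintype (W i)] [∀ i, Nonempty (W i)] :
    ∃ ν : OuterMeasure (∀ i, W i), ν univ = 1 ∧ ∀ (k : ℕ) (ω : ∀ i, W i),
      ν {ω' | ∀ i < k, ω' i = ω i} = ∏ i ∈ Finset.range k, (Fintype.card (W i) : ℝ≥0∞)⁻¹ := by
  let _ : ∀ i, MeasurableSpace (W i) := fun _ => ⊤
  have : ∀ i, MeasurableSingletonClass (W i) := fun _ => ⟨fun _ => trivial⟩
  let ν := Measure.infinitePi fun i => ProbabilityTheory.uniformOn (univ : Set (W i))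
  refine ⟨ν.toOuterMeasure, measure_univ (μ := ν), fun k ω => ?_⟩
  have hset : {ω' : ∀ i, W i | ∀ i < k, ω' i = ω i} =
      Set.pi (Finset.range k : Finset ℕ) fun i => {ω i} := by
    ext; simp [Set.pi]
  rw [hset]
  change ν _ = _
  rw [Measure.infinitePi_pi _ fun i _ => measurableSet_singleton _]
  refine Finset.prod_congr rfl fun i _ => ?_
  rw [ProbabilityTheory.uniformOn_univ, Measure.count_singleton, one_div]

variable {A : Type}

/-- The words obtained from `g₀` by successively gluing the words `ω 0, ω 1, …` on the right. -/
def concat {G : Set (List A)} (glue : G → G → List A)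
    (hglue : ∀ v w : G, v.val ++ glue v w ++ w.val ∈ G) (g₀ : G) (ω : ℕ → G) : ℕ → G
  | 0 => g₀
  | k + 1 => ⟨_, hglue (concat glue hglue g₀ ω k) (ω k)⟩

variable {X : Set (ℕ → A)} {G : Set (List A)} {glue : G → G → List A}
  {hglue : ∀ v w : G, v.val ++ glue v w ++ w.val ∈ G} {g₀ : G} {τ : ℕ}

lemma concat_succ (ω : ℕ → G) (k : ℕ) : (concat glue hglue g₀ ω (k + 1)).val =
    (concat glue hglue g₀ ω k).val ++ glue (concat glue hglue g₀ ω k) (ω k) ++ (ω k).val := rfl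

lemma concat_congr {ω ω' : ℕ → G} {k : ℕ} (h : ∀ i < k, ω i = ω' i) :
    concat glue hglue g₀ ω k = concat glue hglue g₀ ω' k := by
  induction k with
  | zero => rfl
  | succ k ih =>
    rw [Subtype.ext_iff, concat_succ, concat_succ, ih fun i hi => h i (by omega),
      h k (by omega)]

lemma exists_mem_cylinder_concat [TopologicalSpace A] [DiscreteTopology A] [CompactSpace X]
    (hG : G ⊆ language X) (ω : ℕ → G) :
    ∃ x : X, ∀ k, x.val ∈ cylinder (concat glue hglue g₀ ω k).val := by
  have hcl : ∀ k, IsClosed (Subtype.val ⁻¹' cylinder (concat glue hglue g₀ ω k).val : Set X) :=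
    fun k => (isClosed_cylinder _).preimage continuous_subtype_val
  obtain ⟨x, hx⟩ := IsCompact.nonempty_iInter_of_sequence_nonempty_isCompact_isClosed
    (fun k => (Subtype.val ⁻¹' cylinder (concat glue hglue g₀ ω k).val : Set X))
    (fun k x hx => by
      rw [mem_preimage, concat_succ, List.append_assoc, mem_cylinder_append] at hx
      exact hx.1)
    (fun k => by
      obtain ⟨x, hx, hxX⟩ := hG (concat glue hglue g₀ ω k).2
      exact ⟨⟨x, hxX⟩, hx⟩)
    (hcl 0).isCompact hcl
  exact ⟨x, fun k => mem_iInter.1 hx k⟩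

lemma length_concat_le (hτ : ∀ v w, (glue v w).length ≤ τ) {N : ℕ → ℕ} {ω : ℕ → G}
    (hω : ∀ i, (ω i).val.length = N i) (k : ℕ) :
    (concat glue hglue g₀ ω k).val.length ≤
      g₀.val.length + τ * k + ∑ i ∈ Finset.range k, N i := by
  induction k with
  | zero => simp [concat]
  | succ k ih =>
    rw [concat_succ, List.length_append, List.length_append, hω, Finset.sum_range_succ, mul_add]
    have := hτ (concat glue hglue g₀ ω k) (ω k)
    omega

lemma le_length_concat {N : ℕ → ℕ} {ω : ℕ → G} (hω : ∀ i, (ω i).val.length = N i) (k : ℕ) :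
    ∑ i ∈ Finset.range k, N i ≤ (concat glue hglue g₀ ω k).val.length := by
  induction k with
  | zero => simp
  | succ k ih =>
    rw [concat_succ, List.length_append, List.length_append, hω, Finset.sum_range_succ]
    omega

lemma exists_finset_of_concat_prefix (hτ : ∀ v w, (glue v w).length ≤ τ) {N : ℕ → ℕ}
    {W : ℕ → Type} [∀ i, Nonempty (W i)] (ι : ∀ i, W i → G) (hι : ∀ i, Function.Injective (ι i))
    (hN : ∀ i d, (ι i d).val.length = N i) (w : List A) (k : ℕ) :
    ∃ F : Finset (∀ i, W i), F.card ≤ (τ + 1) ^ k ∧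
      ∀ ω : ∀ i, W i, (concat glue hglue g₀ (fun i => ι i (ω i)) k).val <+: w →
        ∃ ω' ∈ F, ∀ i < k, ω i = ω' i := by
  induction k with
  | zero =>
    obtain ⟨ω₀⟩ : Nonempty (∀ i, W i) := inferInstance
    exact ⟨{ω₀}, by simp, fun ω _ => ⟨ω₀, by simp, by simp⟩⟩
  | succ k ih =>
    obtain ⟨F, hF, hFω⟩ := ih
    let V : (∀ i, W i) → G := fun ω => concat glue hglue g₀ (fun i => ι i (ω i)) k
    let slice : (∀ i, W i) → ℕ → List A := fun ω t => (w.drop ((V ω).val.length + t)).take (N k)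
    let pick : (∀ i, W i) → ℕ → W k := fun ω t =>
      if h : ∃ d, (ι k d).val = slice ω t then h.choose else ω k
    refine ⟨(F ×ˢ Finset.range (τ + 1)).image fun p => Function.update p.1 k (pick p.1 p.2),
      ?_, fun ω hω => ?_⟩
    · refine Finset.card_image_le.trans ?_
      rw [Finset.card_product, Finset.card_range, pow_succ]
      gcongr
    · rw [concat_succ] at hω
      have hV : (V ω).val <+: w := by
        refine List.IsPrefix.trans ?_ hω
        rw [List.append_assoc]
        exact List.prefix_append _ _
      obtain ⟨ω', hω', hag⟩ := hFω ω hV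
      have hVV : V ω = V ω' := concat_congr fun i hi => by rw [hag i hi]
      set u := glue (V ω) (ι k (ω k))
      have hu : u.length < τ + 1 := Nat.lt_succ_of_le (hτ _ _)
      have hslice : (ι k (ω k)).val = slice ω' u.length := by
        obtain ⟨s, hs⟩ := hω
        simp only [slice]
        rw [← hVV, ← hs, ← List.length_append, List.append_assoc _ _ s, List.drop_left',
          ← hN k (ω k), List.take_left']
        · rfl
        · rfl
      have hex : ∃ d, (ι k d).val = slice ω' u.length := ⟨ω k, hslice⟩
      have hpick : pick ω' u.length = ω k := by
        simp only [pick]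
        rw [dif_pos hex]
        exact hι k (Subtype.ext (hex.choose_spec.trans hslice.symm))
      refine ⟨_, Finset.mem_image.2 ⟨(ω', u.length), by simp [hω', hu], rfl⟩, fun i hi => ?_⟩
      rcases eq_or_ne i k with rfl | hik
      · simp [hpick]
      · simp [hik, hag i (by omega)]

lemma abs_birkhoff_concat_le (hX : MapsTo shift X X) (hτ : ∀ v w, (glue v w).length ≤ τ)
    {N : ℕ → ℕ} {e : ℕ → ℝ} {ω : ℕ → G} {f : X → ℝ} {C : ℝ} (hC : ∀ x, |f x| ≤ C)
    (hω : ∀ i, ∀ y : X, y.val ∈ cylinder (ω i).val →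
      |birkhoff (subShift X) f (ω i).val.length y| ≤ e i * N i)
    {x : X} (hx : ∀ k, x.val ∈ cylinder (concat glue hglue g₀ ω k).val) (k : ℕ) :
    |birkhoff (subShift X) f (concat glue hglue g₀ ω k).val.length x| ≤
      C * (g₀.val.length + τ * k) + ∑ i ∈ Finset.range k, e i * N i := by
  have hC0 : 0 ≤ C := (abs_nonneg _).trans (hC x)
  induction k with
  | zero => simpa [concat] using abs_birkhoff_le (subShift X) hC g₀.val.length x
  | succ k ih =>
    have hxk := hx (k + 1)
    rw [concat_succ, mem_cylinder_append] at hxk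
    rw [concat_succ, List.length_append, birkhoff_add, List.length_append, birkhoff_add,
      Finset.sum_range_succ]
    have h1 := abs_birkhoff_le (subShift X) hC (glue (concat glue hglue g₀ ω k) (ω k)).length
      ((subShift X)^[(concat glue hglue g₀ ω k).val.length] x)
    have h2 := hω k ((subShift X)^[((concat glue hglue g₀ ω k).val ++
      glue (concat glue hglue g₀ ω k) (ω k)).length] x) (by
        convert hxk.2 using 1
        funext i
        exact iterate_subShift_val hX _ _ _)
    have h3 : C * (glue (concat glue hglue g₀ ω k) (ω k)).length ≤ C * τ := by
      gcongr; exact hτ _ _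
    rw [List.length_append] at h2
    push_cast
    rw [abs_le] at ih h1 h2 ⊢
    constructor <;> linarith [ih.1, ih.2, h1.1, h1.2, h2.1, h2.2]

end Concatenations

section LowerBound

lemma exists_le_lt_succ {l : ℕ → ℕ} {n : ℕ} (h₀ : l 0 ≤ n) (h : ∃ k, n < l k) :
    ∃ k, l k ≤ n ∧ n < l (k + 1) := by
  obtain ⟨j, hj⟩ : ∃ j, Nat.find h = j + 1 := Nat.exists_eq_succ_of_ne_zero fun h0 => by
    have := Nat.find_spec h
    rw [h0] at this
    omega
  refine ⟨j, not_lt.1 (Nat.find_min h (by omega)), ?_⟩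
  rw [← hj]
  exact Nat.find_spec h

lemma exists_error_le {N : ℕ → ℕ} {e : ℕ → ℝ} (h1 : ∀ i, 1 ≤ e i * N i)
    (h2 : ∀ ε : ℝ, 0 < ε → ∃ C : ℝ, ∀ i, (N i : ℝ) ≤ ε * i + C)
    (h3 : ∀ ε : ℝ, 0 < ε → ∃ C : ℝ, ∀ k, ∑ i ∈ Finset.range k, e i * N i ≤
      ε * ∑ i ∈ Finset.range k, (N i : ℝ) + C) {a ε : ℝ} (ha : 0 ≤ a) (hε : 0 < ε) :
    ∃ C : ℝ, ∀ k, a * k + a * N k + ∑ i ∈ Finset.range k, e i * N i ≤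
      ε * ∑ i ∈ Finset.range k, (N i : ℝ) + C := by
  obtain ⟨C₁, hC₁⟩ := h2 1 one_pos
  obtain ⟨C₂, hC₂⟩ := h3 (ε / (2 * a + 1)) (by positivity)
  refine ⟨a * C₁ + (2 * a + 1) * C₂, fun k => ?_⟩
  have hk : (k : ℝ) ≤ ∑ i ∈ Finset.range k, e i * N i := by
    have := Finset.sum_le_sum fun i (_ : i ∈ Finset.range k) => h1 i
    simpa using this
  have e1 : a * N k ≤ a * (1 * k + C₁) := by gcongr; exact hC₁ k
  have e2 : a * k ≤ a * ∑ i ∈ Finset.range k, e i * N i := by gcongr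
  have e3 : (2 * a + 1) * ∑ i ∈ Finset.range k, e i * N i ≤
      (2 * a + 1) * (ε / (2 * a + 1) * ∑ i ∈ Finset.range k, (N i : ℝ) + C₂) := by
    gcongr; exact hC₂ k
  have e4 : (2 * a + 1) * (ε / (2 * a + 1) * ∑ i ∈ Finset.range k, (N i : ℝ) + C₂) =
      ε * ∑ i ∈ Finset.range k, (N i : ℝ) + (2 * a + 1) * C₂ := by
    field_simp
  linarith

lemma mem_levelSet_of_forall_abs_le {Y : Type*} {σ : Y → Y} {f : Y → ℝ} {α : ℝ} {y : Y}
    (h : ∀ ε : ℝ, 0 < ε → ∃ C : ℝ, ∀ n : ℕ, |birkhoff σ f n y - n * α| ≤ ε * n + C) :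
    y ∈ levelSet σ f α := by
  refine Metric.tendsto_atTop'.2 fun ε hε => ?_
  obtain ⟨C, hC⟩ := h (ε / 2) (half_pos hε)
  obtain ⟨m, hm⟩ := exists_nat_gt (2 * C / ε)
  refine ⟨m, fun n hn => ?_⟩
  have hn0 : (0 : ℝ) < n := by exact_mod_cast (Nat.zero_le m).trans_lt hn
  have hmn : (m : ℝ) < n := by exact_mod_cast hn
  have hCn : 2 * C < n * ε := (div_lt_iff₀ hε).1 (hm.trans hmn)
  have heq : birkAvg σ f n y - α = (birkhoff σ f n y - n * α) / n := by
    rw [birkAvg]; field_simp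
  rw [Real.dist_eq, heq, abs_div, abs_of_pos hn0, div_lt_iff₀ hn0]
  have := hC n
  linarith

variable {A : Type} {X : Set (ℕ → A)}

lemma one_le_McalLim {φ : X → ℝ} {Z : Set X} {t : ℝ} {Ω : Type*} {ν : OuterMeasure Ω}
    (hν : ν univ = 1) {x : Ω → X} (hx : ∀ ω, x ω ∈ Z) {L : ℕ}
    (hL : ∀ w : List A, L < w.length → ν {ω | (x ω).val ∈ cylinder w} ≤
      ENNReal.ofReal (Real.exp (-t * w.length +
        sSup (birkhoff (subShift X) φ w.length '' (Subtype.val ⁻¹' cylinder w))))) :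
    1 ≤ McalLim X φ Z t := by
  refine le_trans ?_ (le_iSup _ L)
  refine le_iInf fun S => le_iInf fun hS => le_iInf fun hSL => le_iInf fun hcov => ?_
  have hsub : (univ : Set Ω) ⊆ ⋃ w ∈ S, {ω | (x ω).val ∈ cylinder w} := fun ω _ => by
    have := hcov (hx ω)
    simpa using this
  rw [← hν]
  refine (ν.mono hsub).trans ?_
  refine (measure_biUnion_le ν hS _).trans ?_
  exact ENNReal.tsum_le_tsum fun w => hL w.1 (hSL w.1 w.2)

section Concatenations

variable {G : Set (List A)} {glue : G → G → List A}
  {hglue : ∀ v w : G, v.val ++ glue v w ++ w.val ∈ G} {g₀ : G} {τ : ℕ}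

lemma exists_abs_birkhoff_concat_le (hX : MapsTo shift X X) (hτ : ∀ v w, (glue v w).length ≤ τ)
    {N : ℕ → ℕ} {e : ℕ → ℝ} (h1 : ∀ i, 1 ≤ e i * N i)
    (h2 : ∀ ε : ℝ, 0 < ε → ∃ C : ℝ, ∀ i, (N i : ℝ) ≤ ε * i + C)
    (h3 : ∀ ε : ℝ, 0 < ε → ∃ C : ℝ, ∀ k, ∑ i ∈ Finset.range k, e i * N i ≤
      ε * ∑ i ∈ Finset.range k, (N i : ℝ) + C)
    {f : X → ℝ} {C ε : ℝ} (hC : ∀ x, |f x| ≤ C) (hε : 0 < ε) (hC0 : 0 ≤ C) :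
    ∃ C' : ℝ, ∀ (ω : ℕ → G) (x : X), (∀ i, (ω i).val.length = N i) →
      (∀ i, ∀ y : X, y.val ∈ cylinder (ω i).val →
        |birkhoff (subShift X) f (N i) y| ≤ e i * N i) →
      (∀ k, x.val ∈ cylinder (concat glue hglue g₀ ω k).val) →
      ∀ n : ℕ, |birkhoff (subShift X) f n x| ≤ ε * n + C' := by
  obtain ⟨D, hD⟩ := exists_error_le h1 h2 h3 (a := C * τ + C) (by positivity) hε
  refine ⟨C * g₀.val.length + C * τ + |D|, fun ω x hω hf hx n => ?_⟩
  set l := fun k => (concat glue hglue g₀ ω k).val.length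
  rcases lt_or_ge n (l 0) with hn | hn
  · have := abs_birkhoff_le (subShift X) hC n x
    have h4 : C * n ≤ C * g₀.val.length := by gcongr; exact hn.le
    have h5 : 0 ≤ ε * (n : ℝ) := by positivity
    have h6 : 0 ≤ C * (τ : ℝ) := by positivity
    linarith [abs_nonneg D]
  · have hNpos : ∀ i, 1 ≤ N i := fun i => Nat.one_le_iff_ne_zero.2 fun h0 => by
      have := h1 i
      rw [h0] at this
      norm_num at this
    have hsl := fun k => le_length_concat (glue := glue) (hglue := hglue) (g₀ := g₀) hω k
    obtain ⟨k, hk, hk'⟩ := exists_le_lt_succ hn ⟨n + 1, by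
      refine lt_of_lt_of_le ?_ (hsl (n + 1))
      have := Finset.sum_le_sum fun i (_ : i ∈ Finset.range (n + 1)) => hNpos i
      simp at this
      omega⟩
    obtain ⟨r, rfl⟩ := Nat.exists_eq_add_of_le hk
    have hb := abs_birkhoff_concat_le hX hτ hC (fun i y hy => by rw [hω i]; exact hf i y hy) hx k
    have hr : r ≤ τ + N k := by
      simp only [l, concat_succ, List.length_append, hω] at hk'
      have := hτ (concat glue hglue g₀ ω k) (ω k)
      omega
    have hr' : (r : ℝ) ≤ τ + N k := by exact_mod_cast hr
    have hb2 := abs_birkhoff_le (subShift X) hC r ((subShift X)^[l k] x)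
    have hDk := hD k
    have hs : (∑ i ∈ Finset.range k, (N i : ℝ)) ≤ (l k + r : ℕ) := by
      exact_mod_cast (hsl k).trans (Nat.le_add_right _ r)
    have hs' : ε * ∑ i ∈ Finset.range k, (N i : ℝ) ≤ ε * (l k + r : ℕ) := by gcongr
    have hCr : C * r ≤ C * (τ + N k) := by gcongr
    have hCk : 0 ≤ C * (k : ℝ) := by positivity
    have hCN : 0 ≤ C * τ * (N k : ℝ) := by positivity
    rw [birkhoff_add]
    refine (abs_add_le _ _).trans ?_
    linarith [le_abs_self D]

lemma exists_measure_concat_le (hτ : ∀ v w, (glue v w).length ≤ τ)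
    {N : ℕ → ℕ} {e : ℕ → ℝ} (h1 : ∀ i, 1 ≤ e i * N i)
    (h2 : ∀ ε : ℝ, 0 < ε → ∃ C : ℝ, ∀ i, (N i : ℝ) ≤ ε * i + C)
    (h3 : ∀ ε : ℝ, 0 < ε → ∃ C : ℝ, ∀ k, ∑ i ∈ Finset.range k, e i * N i ≤
      ε * ∑ i ∈ Finset.range k, (N i : ℝ) + C)
    {W : ℕ → Type} [∀ i, Nonempty (W i)] [∀ i, Fintype (W i)] (ι : ∀ i, W i → G)
    (hι : ∀ i, Function.Injective (ι i)) (hN : ∀ i d, (ι i d).val.length = N i)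
    {h : ℝ} (hh : 0 ≤ h) (hW : ∀ i, Real.exp (N i * (h - e i)) ≤ Fintype.card (W i))
    {ν : OuterMeasure (∀ i, W i)}
    (hν : ∀ (k : ℕ) (ω : ∀ i, W i), ν {ω' | ∀ i < k, ω' i = ω i} =
      ∏ i ∈ Finset.range k, (Fintype.card (W i) : ℝ≥0∞)⁻¹)
    {x : (∀ i, W i) → X}
    (hx : ∀ ω k, (x ω).val ∈ cylinder (concat glue hglue g₀ (fun i => ι i (ω i)) k).val)
    {ε : ℝ} (hε : 0 < ε) :
    ∃ (C : ℝ) (L : ℕ), ∀ w : List A, L ≤ w.length → ν {ω | (x ω).val ∈ cylinder w} ≤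
      ENNReal.ofReal (Real.exp ((ε - h) * w.length + C)) := by
  have hlog : 0 ≤ Real.log (τ + 1) := Real.log_nonneg (by simp)
  obtain ⟨D, hD⟩ := exists_error_le h1 h2 h3 (a := Real.log (τ + 1) + h * (τ + 1))
    (by positivity) hε
  refine ⟨h * (g₀.val.length + τ) + |D|, g₀.val.length, fun w hw => ?_⟩
  set s := fun k => ∑ i ∈ Finset.range k, N i
  have hNpos : ∀ i, 1 ≤ N i := fun i => Nat.one_le_iff_ne_zero.2 fun h0 => by
    have := h1 i
    rw [h0] at this
    norm_num at this
  obtain ⟨k, hk, hk'⟩ := exists_le_lt_succ (l := fun k => g₀.val.length + τ * k + s k)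
    (n := w.length) (by simpa [s] using hw) ⟨w.length + 1, by
      have := Finset.sum_le_sum fun i (_ : i ∈ Finset.range (w.length + 1)) => hNpos i
      simp at this
      have : w.length + 1 ≤ s (w.length + 1) := this
      exact lt_of_lt_of_le (Nat.lt_succ_self _) (this.trans (Nat.le_add_left _ _))⟩
  obtain ⟨F, hF, hFω⟩ := exists_finset_of_concat_prefix (hglue := hglue) (g₀ := g₀) hτ ι hι hN w k
  have hsub : {ω | (x ω).val ∈ cylinder w} ⊆ ⋃ ω' ∈ F, {ω | ∀ i < k, ω i = ω' i} := by
    intro ω hω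
    have hlen := length_concat_le (hglue := hglue) (g₀ := g₀) hτ (ω := fun i => ι i (ω i))
      (fun i => hN i (ω i)) k
    replace hlen := hlen.trans hk
    have hpre : (concat glue hglue g₀ (fun i => ι i (ω i)) k).val <+: w := by
      have e1 := mem_cylinder_iff.1 (hx ω k)
      have e2 := mem_cylinder_iff.1 hω
      rw [List.prefix_iff_eq_take, ← e2, ← e1]
      refine List.ext_getElem ?_ fun i hi hi' => ?_
      · simp only [length_prefixWord, List.length_take]
        omega
      · simp [prefixWord]
    obtain ⟨ω', hω', hag⟩ := hFω ω hpre
    exact mem_iUnion₂.2 ⟨ω', hω', hag⟩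
  refine (measure_mono hsub).trans ((measure_biUnion_finset_le F _).trans ?_)
  simp only [hν]
  rw [Finset.sum_const, nsmul_eq_mul]
  have hprod : ∏ i ∈ Finset.range k, (Fintype.card (W i) : ℝ≥0∞)⁻¹ ≤
      ENNReal.ofReal (Real.exp (∑ i ∈ Finset.range k, -(N i * (h - e i)))) := by
    rw [Real.exp_sum, ENNReal.ofReal_prod_of_nonneg fun _ _ => (Real.exp_pos _).le]
    refine Finset.prod_le_prod' fun i _ => ?_
    rw [Real.exp_neg, ENNReal.ofReal_inv_of_pos (Real.exp_pos _), ENNReal.inv_le_inv]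
    rw [← ENNReal.ofReal_natCast]
    exact ENNReal.ofReal_le_ofReal (hW i)
  have hcard : (F.card : ℝ≥0∞) ≤ ENNReal.ofReal (Real.exp (k * Real.log (τ + 1))) := by
    rw [Real.exp_nat_mul, Real.exp_log (by positivity), ← ENNReal.ofReal_natCast]
    refine ENNReal.ofReal_le_ofReal ?_
    exact_mod_cast hF
  refine (mul_le_mul' hcard hprod).trans ?_
  rw [← ENNReal.ofReal_mul (Real.exp_pos _).le, ← Real.exp_add]
  refine ENNReal.ofReal_le_ofReal (Real.exp_le_exp.2 ?_)
  have hsum : ∑ i ∈ Finset.range k, -(N i * (h - e i)) =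
      ∑ i ∈ Finset.range k, e i * N i - h * s k := by
    simp only [s]
    push_cast
    rw [Finset.mul_sum, ← Finset.sum_sub_distrib]
    exact Finset.sum_congr rfl fun i _ => by ring
  rw [hsum]
  have hk1 : (w.length : ℝ) ≤ g₀.val.length + τ * (k + 1) + (s k + N k) := by
    have : s (k + 1) = s k + N k := Finset.sum_range_succ _ _
    rw [this] at hk'
    exact_mod_cast hk'.le
  have hk2 : (s k : ℝ) ≤ w.length := by
    exact_mod_cast (Nat.le_add_left _ _).trans hk
  have hDk := hD k
  have hsr : (s k : ℝ) = ∑ i ∈ Finset.range k, (N i : ℝ) := by simp [s]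
  rw [← hsr] at hDk
  have e1 := mul_le_mul_of_nonneg_left hk1 hh
  have e2 := mul_le_mul_of_nonneg_left hk2 hε.le
  have e3 : 0 ≤ Real.log (τ + 1) * N k := by positivity
  have e4 : 0 ≤ h * k := by positivity
  have e5 : 0 ≤ h * τ * N k := by positivity
  linarith [le_abs_self D]

end Concatenations

variable [Fintype A] [MeasurableSpace A] [TopologicalSpace A] [DiscreteTopology A] [BorelSpace A]

theorem le_of_McalLim_levelSet_eq_zero [CompactSpace X] (hX : MapsTo shift X X) {G : Set (List A)}
    (hG : G ⊆ language X) (hspec : HasSpecW (language X) G)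
    (happ : EditApproachable (language X) G)
    {μ : ProbabilityMeasure X} (hμ : IsInvariant (subShift X) μ) {φ ψ : X → ℝ}
    (hφ : Continuous φ) (hψ : Continuous ψ) {t : ℝ}
    (ht : McalLim X φ (levelSet (subShift X) ψ (∫ y, ψ y ∂μ.toMeasure)) t = 0) :
    entropy X μ + ∫ y, φ y ∂μ.toMeasure ≤ t := by
  obtain ⟨N, D, e, h1, h2, h3, h4, h5⟩ := exists_block_sequence hX hspec happ hμ hφ hψ
  by_contra! hlt
  set h := entropy X μ
  set β := ∫ y, φ y ∂μ.toMeasure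
  set α := ∫ y, ψ y ∂μ.toMeasure
  obtain ⟨τ, hspec⟩ := hspec
  have hspec' : ∀ v w : G, ∃ u : List A, u.length ≤ τ ∧ v.val ++ u ++ w.val ∈ G := fun v w =>
    (hspec v.1 v.2 w.1 w.2).imp fun u hu => hu.2
  choose glue hτ hglue using hspec'
  let W : ℕ → Type := fun i => D i
  have hWne : ∀ i, Nonempty (W i) := fun i => by
    rw [Finset.nonempty_coe_sort, ← Finset.card_pos]
    exact_mod_cast (Real.exp_pos _).trans_le (h5 i)
  let ι : ∀ i, W i → G := fun i d => ⟨d.1, (h4 i d.1 d.2).1⟩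
  have hι : ∀ i, Function.Injective (ι i) := fun i d d' hd =>
    Subtype.ext (congrArg (fun v : G => v.val) hd)
  have hN : ∀ i d, (ι i d).val.length = N i := fun i d => (h4 i d.1 d.2).2.1
  obtain ⟨d₀⟩ := hWne 0
  let g₀ : G := ι 0 d₀
  choose x hx using fun ω : ∀ i, W i =>
    exists_mem_cylinder_concat (hglue := hglue) (g₀ := g₀) hG fun i => ι i (ω i)
  obtain ⟨ν, hν1, hν⟩ := exists_uniform_product W
  have hclose : ∀ (f : X → ℝ) (a : ℝ), Continuous f →
      (∀ i, ∀ d : W i, ∀ y : X, y.val ∈ cylinder d.1 →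
        |birkhoff (subShift X) f (N i) y - N i * a| ≤ e i * N i) → ∀ ε : ℝ, 0 < ε →
      ∃ C : ℝ, ∀ ω (n : ℕ), |birkhoff (subShift X) f n (x ω) - n * a| ≤ ε * n + C := by
    intro f a hf hfa ε hε
    obtain ⟨C, hC0, hC⟩ := exists_abs_le (f := fun y => f y - a) (by fun_prop)
    obtain ⟨C', hC'⟩ := exists_abs_birkhoff_concat_le (hglue := hglue) (g₀ := g₀) hX hτ h1 h2 h3
      hC hε hC0.le
    refine ⟨C', fun ω n => ?_⟩
    have := hC' (fun i => ι i (ω i)) (x ω) (fun i => hN i _) (fun i y hy => by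
      rw [birkhoff_sub_const]
      exact hfa i (ω i) y hy) (hx ω) n
    rwa [birkhoff_sub_const] at this
  have hmem : ∀ ω, x ω ∈ levelSet (subShift X) ψ α := fun ω =>
    mem_levelSet_of_forall_abs_le fun ε hε => by
      obtain ⟨C, hC⟩ := hclose ψ α hψ (fun i d y hy => ((h4 i d.1 d.2).2.2 y hy).2) ε hε
      exact ⟨C, hC ω⟩
  set ε := (h + β - t) / 4
  have hε : 0 < ε := by simp only [ε]; linarith
  obtain ⟨C₁, hC₁⟩ := hclose φ β hφ (fun i d y hy => ((h4 i d.1 d.2).2.2 y hy).1) ε hε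
  obtain ⟨C₂, L, hC₂⟩ := exists_measure_concat_le hτ h1 h2 h3 ι hι hN (entropy_nonneg μ)
    (fun i => by rw [Fintype.card_coe]; exact h5 i) hν hx hε
  obtain ⟨B, -, hB⟩ := exists_abs_le hφ
  obtain ⟨M, hM⟩ := exists_nat_gt ((C₁ + C₂) / (2 * ε))
  have hone := one_le_McalLim (φ := φ) (t := t) (L := max L M) hν1 hmem fun w hw => by
    rcases eq_empty_or_nonempty {ω | (x ω).val ∈ cylinder w} with h0 | ⟨ω, hω⟩
    · rw [h0, measure_empty]
      exact zero_le
    · refine (hC₂ w ((le_max_left _ _).trans hw.le)).trans ?_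
      refine ENNReal.ofReal_le_ofReal (Real.exp_le_exp.2 ?_)
      have hle : birkhoff (subShift X) φ w.length (x ω) ≤
          sSup (birkhoff (subShift X) φ w.length '' (Subtype.val ⁻¹' cylinder w)) := by
        refine le_csSup ⟨B * w.length, ?_⟩ ⟨x ω, hω, rfl⟩
        rintro _ ⟨y, -, rfl⟩
        exact (le_abs_self _).trans (abs_birkhoff_le _ hB _ _)
      have hlow := (abs_le.1 (hC₁ ω w.length)).1
      have hMw : (M : ℝ) ≤ w.length := by exact_mod_cast (le_max_right _ _).trans hw.le
      have hCM := (div_le_iff₀ (by positivity)).1 (hM.le.trans hMw)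
      have hε4 : h + β - t = 4 * ε := by simp only [ε]; ring
      have hβ : (h + β - t) * w.length = 4 * ε * w.length := by rw [hε4]
      linarith
  rw [ht] at hone
  exact absurd hone (by simp)

end LowerBound

section OrbitMeasures

lemma sum_negMulLog_le {ι : Type*} {s : Finset ι} {q c : ι → ℝ} (hq : ∀ x ∈ s, 0 < q x)
    (hq1 : ∑ x ∈ s, q x = 1) (hc : ∑ x ∈ s, Real.exp (-c x) ≤ 1) :
    ∑ x ∈ s, Real.negMulLog (q x) ≤ ∑ x ∈ s, q x * c x := by
  have h : ∀ x ∈ s, Real.negMulLog (q x) ≤ q x * c x + (Real.exp (-c x) - q x) := by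
    intro x hx
    have hqx := hq x hx
    have h1 := Real.log_le_sub_one_of_pos (x := Real.exp (-c x) / q x) (by positivity)
    rw [Real.log_div (Real.exp_ne_zero _) hqx.ne', Real.log_exp] at h1
    have h2 := mul_le_mul_of_nonneg_left h1 hqx.le
    rw [mul_sub, mul_sub, mul_div_cancel₀ _ hqx.ne'] at h2
    rw [Real.negMulLog]
    linarith
  refine (Finset.sum_le_sum h).trans ?_
  rw [Finset.sum_add_distrib, Finset.sum_sub_distrib, hq1]
  linarith

lemma sum_range_sum_range (m b : ℕ) (f : ℕ → ℝ) :
    ∑ k ∈ Finset.range m, ∑ a ∈ Finset.range b, f (k + a * m) =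
      ∑ i ∈ Finset.range (b * m), f i := by
  induction b with
  | zero => simp
  | succ b ih =>
    simp only [Finset.sum_range_succ, Finset.sum_add_distrib, ih]
    rw [Nat.succ_mul, Finset.sum_range_add]
    simp only [add_comm]

variable {A : Type} [Fintype A] {X : Set (ℕ → A)}

lemma sum_block_product_le {m : ℕ} {p : (Fin m → A) → ℝ} (hp : ∀ v, 0 ≤ p v)
    (hp1 : ∑ v, p v = 1) {κ : ℝ} (hκ : 0 ≤ κ) (hκ1 : Fintype.card A * κ ≤ 1) (k b r : ℕ)
    {s : Finset (ℕ → A)}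
    (hs : ∀ x ∈ s, ∀ y ∈ s, (∀ i < k + b * m + r, x i = y i) → x = y) :
    ∑ x ∈ s, κ ^ (k + r) * ∏ a ∈ Finset.range b, p (fun i : Fin m => x (i + (k + a * m))) ≤ 1 := by
  let E : (ℕ → A) → (Fin k → A) × (Fin b → Fin m → A) × (Fin r → A) := fun x =>
    (fun i => x i, fun a i => x (i + (k + a * m)), fun i => x (k + b * m + i))
  let g : (Fin k → A) × (Fin b → Fin m → A) × (Fin r → A) → ℝ := fun z =>
    κ ^ (k + r) * ∏ a, p (z.2.1 a)
  have hE : Set.InjOn E s := by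
    intro x hx y hy hxy
    refine hs x hx y hy fun i hi => ?_
    rw [Prod.ext_iff, Prod.ext_iff] at hxy
    obtain ⟨h1, h2, h3⟩ := hxy
    rcases lt_or_ge i k with hik | hik
    · exact congrFun h1 ⟨i, hik⟩
    obtain ⟨j, rfl⟩ := Nat.exists_eq_add_of_le hik
    rcases lt_or_ge j (b * m) with hj | hj
    · have hm : 0 < m := Nat.pos_of_ne_zero fun h => by simp [h] at hj
      have := congrFun (congrFun h2 ⟨j / m, Nat.div_lt_of_lt_mul (by rwa [mul_comm])⟩)
        ⟨j % m, Nat.mod_lt _ hm⟩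
      have hdm : j % m + (k + j / m * m) = k + j := by
        have := Nat.mod_add_div' j m
        omega
      simpa only [E, hdm] using this
    · obtain ⟨l, rfl⟩ := Nat.exists_eq_add_of_le hj
      have := congrFun h3 ⟨l, by omega⟩
      simpa only [E, add_assoc] using this
  have hsum : ∑ x ∈ s, κ ^ (k + r) * ∏ a ∈ Finset.range b,
      p (fun i : Fin m => x (i + (k + a * m))) = ∑ z ∈ s.image E, g z := by
    rw [Finset.sum_image hE]
    refine Finset.sum_congr rfl fun x _ => ?_
    simp only [g, E]
    rw [Finset.prod_range]
  rw [hsum]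
  calc ∑ z ∈ s.image E, g z ≤ ∑ z, g z :=
        Finset.sum_le_univ_sum_of_nonneg fun z =>
          mul_nonneg (by positivity) (Finset.prod_nonneg fun _ _ => hp _)
    _ = (Fintype.card A * κ) ^ (k + r) * (∑ v, p v) ^ b := by
        simp only [g, Fintype.sum_prod_type, ← Finset.mul_sum, Finset.sum_const, Finset.card_univ,
          Fintype.card_pi, Finset.prod_const, Fintype.card_fin, nsmul_eq_mul, ← Fintype.sum_pow]
        push_cast
        ring
    _ ≤ 1 := by
        rw [hp1, one_pow, mul_one]
        exact pow_le_one₀ (by positivity) hκ1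

variable [TopologicalSpace A] [DiscreteTopology A] [MeasurableSpace A] [BorelSpace A]

lemma exists_orbit_measure {Y : Type*} [MeasurableSpace Y] [MeasurableSingletonClass Y]
    (σ : Y → Y) {n : ℕ} (hn : 1 ≤ n) {s : Finset Y} {q : Y → ℝ}
    (hq : ∀ x ∈ s, 0 < q x) (hq1 : ∑ x ∈ s, q x = 1) :
    ∃ μ : ProbabilityMeasure Y, ∀ f : Y → ℝ,
      ∫ y, f y ∂μ.toMeasure = ∑ x ∈ s, q x * ((n : ℝ)⁻¹ * birkhoff σ f n x) := by
  let ν : Measure Y := ∑ x ∈ s, ENNReal.ofReal (q x) •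
    ∑ i ∈ Finset.range n, ENNReal.ofReal ((n : ℝ)⁻¹) • Measure.dirac (σ^[i] x)
  have hf_int : ∀ (f : Y → ℝ) (x : Y), Integrable f
      (∑ i ∈ Finset.range n, ENNReal.ofReal ((n : ℝ)⁻¹) • Measure.dirac (σ^[i] x)) := fun f x =>
    integrable_finsetSum_measure.2 fun i _ =>
      (integrable_dirac (by simp)).smul_measure ENNReal.ofReal_ne_top
  have hf : ∀ f : Y → ℝ, ∫ y, f y ∂ν = ∑ x ∈ s, q x * ((n : ℝ)⁻¹ * birkhoff σ f n x) := by
    intro f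
    rw [integral_finsetSum_measure fun x _ => (hf_int f x).smul_measure ENNReal.ofReal_ne_top]
    refine Finset.sum_congr rfl fun x hx => ?_
    rw [integral_smul_measure, ENNReal.toReal_ofReal (hq x hx).le, smul_eq_mul,
      integral_finsetSum_measure fun i _ =>
        (integrable_dirac (by simp)).smul_measure ENNReal.ofReal_ne_top]
    congr 1
    rw [birkhoff, Finset.mul_sum]
    refine Finset.sum_congr rfl fun i _ => ?_
    rw [integral_smul_measure, ENNReal.toReal_ofReal (by positivity), integral_dirac, smul_eq_mul]
  have hn0 : (n : ℝ) ≠ 0 := by positivity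
  have hν : IsProbabilityMeasure ν := by
    have h1 := hf fun _ => 1
    simp only [birkhoff, Finset.sum_const, Finset.card_range, nsmul_eq_mul, mul_one,
      inv_mul_cancel₀ hn0, hq1, integral_const, smul_eq_mul] at h1
    refine ⟨?_⟩
    rw [measureReal_def] at h1
    rwa [ENNReal.toReal_eq_one_iff] at h1
  exact ⟨⟨ν, hν⟩, hf⟩

lemma mul_entropy_le_wordEntropy (hX : MapsTo shift X X) {n : ℕ} (hn : 1 ≤ n) {s : Finset X}
    (hs : ∀ x ∈ s, ∀ y ∈ s, (∀ i < n, x.val i = y.val i) → x = y) {q : X → ℝ}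
    (hq : ∀ x ∈ s, 0 < q x) (hq1 : ∑ x ∈ s, q x = 1) {μ : ProbabilityMeasure X}
    (hμ : ∀ f : X → ℝ, ∫ y, f y ∂μ.toMeasure =
      ∑ x ∈ s, q x * ((n : ℝ)⁻¹ * birkhoff (subShift X) f n x)) {m : ℕ} (hm : 1 ≤ m) :
    m * ∑ x ∈ s, Real.negMulLog (q x) ≤
      n * wordEntropy X μ m + 2 * m ^ 2 * Real.log (Fintype.card A) := by
  have hn0 : (0 : ℝ) < n := by positivity
  set p : (Fin m → A) → ℝ := fun v => (μ.toMeasure (Subtype.val ⁻¹' cylF v)).toReal with hpdef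
  set σ := subShift X
  have hp : ∀ v, 0 ≤ p v := fun v => ENNReal.toReal_nonneg
  have hpos : ∀ x ∈ s, ∀ i < n, 0 < p (initWord m (σ^[i] x).val) := by
    intro x hx i hi
    have h1 := (integral_initWord μ fun w : Fin m → A =>
      if w = initWord m (σ^[i] x).val then (1 : ℝ) else 0).symm
    rw [hμ] at h1
    simp only [mul_ite, mul_one, mul_zero, Finset.sum_ite_eq', Finset.mem_univ, if_true] at h1
    simp only [hpdef]
    rw [h1]
    have hnn : ∀ y : X, ∀ j, (0 : ℝ) ≤ if initWord m (σ^[j] y).val = initWord m (σ^[i] x).val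
        then 1 else 0 := fun y j => by positivity
    refine Finset.sum_pos' (fun y hy => ?_) ⟨x, hx, ?_⟩
    · exact mul_nonneg (hq y hy).le
        (mul_nonneg (by positivity) (Finset.sum_nonneg fun j _ => hnn y j))
    · refine mul_pos (hq x hx) (mul_pos (by positivity) ?_)
      exact Finset.sum_pos' (fun j _ => hnn x j) ⟨i, Finset.mem_range.2 hi, by simp⟩
  set F : (Fin m → A) → ℝ := fun v => -Real.log (p v)
  have hF : ∀ v, 0 ≤ F v := fun v => by
    have : p v ≤ 1 := by simp only [hpdef]; rw [← measureReal_def]; exact measureReal_le_one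
    have := Real.log_nonpos (hp v) this
    simp only [F]; linarith
  have hent : wordEntropy X μ m =
      ∑ x ∈ s, q x * ((n : ℝ)⁻¹ * birkhoff σ (fun y => F (initWord m y.val)) n x) := by
    rw [← hμ, integral_initWord μ F, wordEntropy]
    refine Finset.sum_congr rfl fun v _ => ?_
    simp only [F, hpdef, Real.negMulLog]
    ring
  obtain ⟨x₀, hx₀⟩ : s.Nonempty := Finset.nonempty_iff_ne_empty.2 fun h => by simp [h] at hq1
  have hA : (1 : ℝ) ≤ Fintype.card A := by
    have : 0 < Fintype.card A := Fintype.card_pos_iff.2 ⟨x₀.val 0⟩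
    exact_mod_cast this
  have hlog := Real.log_nonneg hA
  set b := n / m
  set r := n % m
  have hbr : b * m + r = n := Nat.div_add_mod' n m
  have hk : ∀ k ∈ Finset.range m, ∑ x ∈ s, Real.negMulLog (q x) ≤
      ∑ x ∈ s, q x * ((k + r : ℕ) * Real.log (Fintype.card A) +
        ∑ a ∈ Finset.range b, F (initWord m (σ^[k + a * m] x).val)) := by
    intro k hkm
    rw [Finset.mem_range] at hkm
    refine sum_negMulLog_le hq hq1 ?_
    have hle := sum_block_product_le hp (sum_cylF μ m) (κ := (Fintype.card A : ℝ)⁻¹)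
      (by positivity) (by rw [mul_inv_cancel₀ (by positivity)]) k b r
      (s := s.map (Function.Embedding.subtype _)) (by
        intro x hx y hy hxy
        obtain ⟨x, hxs, rfl⟩ := Finset.mem_map.1 hx
        obtain ⟨y, hys, rfl⟩ := Finset.mem_map.1 hy
        exact congrArg Subtype.val (hs x hxs y hys fun i hi => hxy i (by omega)))
    refine le_trans (le_of_eq ?_) hle
    rw [Finset.sum_map]
    refine Finset.sum_congr rfl fun x hx => ?_
    rw [neg_add, Real.exp_add, ← mul_neg, Real.exp_nat_mul, Real.exp_neg,
      Real.exp_log (by positivity), ← Finset.sum_neg_distrib, Real.exp_sum]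
    congr 1
    refine Finset.prod_congr rfl fun a ha => ?_
    have hlt : k + a * m < n := by
      have : (a + 1) * m ≤ b * m := Nat.mul_le_mul_right _ (Finset.mem_range.1 ha)
      rw [add_mul] at this
      omega
    simp only [F]
    rw [neg_neg, Real.exp_log (hpos x hx _ hlt)]
    congr 1
    funext i
    exact iterate_subShift_val hX _ _ _
  have hsum := Finset.sum_le_sum hk
  rw [Finset.sum_const, Finset.card_range, nsmul_eq_mul, Finset.sum_comm] at hsum
  refine hsum.trans ?_
  have hbound : ∀ x ∈ s, ∑ k ∈ Finset.range m, q x * ((k + r : ℕ) * Real.log (Fintype.card A) +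
      ∑ a ∈ Finset.range b, F (initWord m (σ^[k + a * m] x).val)) ≤
      q x * (2 * m ^ 2 * Real.log (Fintype.card A)) +
        n * (q x * ((n : ℝ)⁻¹ * birkhoff σ (fun y => F (initWord m y.val)) n x)) := by
    intro x hx
    rw [← Finset.mul_sum, Finset.sum_add_distrib,
      sum_range_sum_range m b fun i => F (initWord m (σ^[i] x).val)]
    have h1 : ∑ k ∈ Finset.range m, ((k + r : ℕ) : ℝ) * Real.log (Fintype.card A) ≤
        2 * m ^ 2 * Real.log (Fintype.card A) := by
      rw [← Finset.sum_mul]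
      gcongr
      refine (Finset.sum_le_card_nsmul _ _ (2 * m : ℝ) fun k hk => ?_).trans (le_of_eq ?_)
      · have : k + r ≤ 2 * m := by
          have := Nat.mod_lt n hm
          have := Finset.mem_range.1 hk
          omega
        exact_mod_cast this
      · rw [Finset.card_range, nsmul_eq_mul]; ring
    have h2 : ∑ i ∈ Finset.range (b * m), F (initWord m (σ^[i] x).val) ≤
        birkhoff σ (fun y => F (initWord m y.val)) n x :=
      Finset.sum_le_sum_of_subset_of_nonneg (Finset.range_subset_range.2 (by omega))
        fun _ _ _ => hF _
    have h3 : n * (q x * ((n : ℝ)⁻¹ * birkhoff σ (fun y => F (initWord m y.val)) n x)) =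
        q x * birkhoff σ (fun y => F (initWord m y.val)) n x := by
      field_simp
    rw [h3, ← mul_add]
    exact mul_le_mul_of_nonneg_left (add_le_add h1 h2) (hq x hx).le
  refine (Finset.sum_le_sum hbound).trans (le_of_eq ?_)
  rw [Finset.sum_add_distrib, ← Finset.mul_sum, ← Finset.sum_mul, hq1, hent]
  ring

end OrbitMeasures

section UpperEstimate

variable {A : Type} {X : Set (ℕ → A)}

lemma McalLim_eq_zero_of_covers {φ : X → ℝ} {Z : Set X} {F : ℕ → Finset (List A)}
    (hlen : ∀ n, ∀ w ∈ F n, w.length = n)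
    (hcov : ∀ x ∈ Z, ∀ m, ∃ n ≥ m, prefixWord x.val n ∈ F n) {t t' : ℝ} (htt : t' < t) {m : ℕ}
    (hsum : ∀ n ≥ m, ∑ w ∈ F n,
      Real.exp (sSup (birkhoff (subShift X) φ n '' (Subtype.val ⁻¹' cylinder w))) ≤
        Real.exp (t' * n)) :
    McalLim X φ Z t = 0 := by
  set ρ : ℝ := Real.exp (t' - t) with hρ
  have hρ0 : 0 < ρ := Real.exp_pos _
  have hρ1 : ρ < 1 := by rw [hρ, Real.exp_lt_one_iff]; linarith
  have hbound : ∀ N k : ℕ, N < k → m ≤ k →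
      Mcal X φ Z t N ≤ ENNReal.ofReal (ρ ^ k * (1 - ρ)⁻¹) := by
    intro N k hNk hmk
    have hS : Z ⊆ ⋃ w ∈ ⋃ i, (F (k + i) : Set (List A)), Subtype.val ⁻¹' cylinder w := by
      intro x hx
      obtain ⟨n, hn, hw⟩ := hcov x hx k
      obtain ⟨i, rfl⟩ := Nat.exists_eq_add_of_le hn
      exact mem_biUnion (mem_iUnion.2 ⟨i, hw⟩) (mem_cylinder_prefixWord x.val _)
    have hlong : ∀ w ∈ ⋃ i, (F (k + i) : Set (List A)), N < w.length := by
      intro w hw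
      obtain ⟨i, hi⟩ := mem_iUnion.1 hw
      rw [hlen _ w hi]
      omega
    rw [Mcal]
    refine (iInf_le _ (⋃ i, (F (k + i) : Set (List A)))).trans <| (iInf_le _
      (countable_iUnion fun i => (F (k + i)).countable_toSet)).trans <| (iInf_le _ hlong).trans <|
      (iInf_le _ hS).trans ?_
    refine (ENNReal.tsum_iUnion_le_tsum (fun w : List A => ENNReal.ofReal
      (Real.exp (-t * w.length + sSup (birkhoff (subShift X) φ w.length ''
        (Subtype.val ⁻¹' cylinder w))))) fun i => (F (k + i) : Set (List A))).trans ?_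
    have hterm : ∀ i, ∑' w : ((F (k + i) : Set (List A))), ENNReal.ofReal
        (Real.exp (-t * (w : List A).length + sSup (birkhoff (subShift X) φ (w : List A).length ''
        (Subtype.val ⁻¹' cylinder (w : List A))))) ≤ ENNReal.ofReal (ρ ^ k * ρ ^ i) := by
      intro i
      rw [Finset.tsum_subtype' (F (k + i)) fun w : List A => ENNReal.ofReal
        (Real.exp (-t * w.length + sSup (birkhoff (subShift X) φ w.length ''
        (Subtype.val ⁻¹' cylinder w)))),
        ← ENNReal.ofReal_sum_of_nonneg fun _ _ => (Real.exp_pos _).le]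
      refine ENNReal.ofReal_le_ofReal ?_
      calc ∑ w ∈ F (k + i), Real.exp (-t * w.length + sSup (birkhoff (subShift X) φ w.length ''
              (Subtype.val ⁻¹' cylinder w)))
          = Real.exp (-t * (k + i : ℕ)) * ∑ w ∈ F (k + i), Real.exp
              (sSup (birkhoff (subShift X) φ (k + i) '' (Subtype.val ⁻¹' cylinder w))) := by
            rw [Finset.mul_sum]
            refine Finset.sum_congr rfl fun w hw => ?_
            rw [hlen _ w hw, Real.exp_add]
        _ ≤ Real.exp (-t * (k + i : ℕ)) * Real.exp (t' * (k + i : ℕ)) := by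
            gcongr
            exact hsum _ (by omega)
        _ = ρ ^ k * ρ ^ i := by
            rw [← pow_add, hρ, ← Real.exp_nat_mul, ← Real.exp_add]
            congr 1
            ring
    refine (ENNReal.tsum_le_tsum hterm).trans (le_of_eq ?_)
    rw [← ENNReal.ofReal_tsum_of_nonneg (fun i => by positivity)
      ((summable_geometric_of_lt_one hρ0.le hρ1).mul_left _), tsum_mul_left,
      tsum_geometric_of_lt_one hρ0.le hρ1]
  have hlim : Tendsto (fun k : ℕ => ENNReal.ofReal (ρ ^ k * (1 - ρ)⁻¹)) atTop (𝓝 0) := by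
    have := ((tendsto_pow_atTop_nhds_zero_of_lt_one hρ0.le hρ1).mul_const (1 - ρ)⁻¹)
    rw [zero_mul] at this
    simpa using ENNReal.tendsto_ofReal this
  refine le_antisymm (iSup_le fun N => ge_of_tendsto hlim ?_) bot_le
  filter_upwards [eventually_gt_atTop N, eventually_ge_atTop m] with k h1 h2
  exact hbound N k h1 h2

variable [Fintype A]

lemma exists_large_sum {φ ψ : X → ℝ} {α t t' : ℝ}
    (ht : McalLim X φ (levelSet (subShift X) ψ α) t ≠ 0) (htt : t' < t) {δ : ℝ} (hδ : 0 < δ)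
    (m : ℕ) :
    ∃ n ≥ m, ∃ (s : Finset X), (∀ x ∈ s, |birkAvg (subShift X) ψ n x - α| ≤ δ) ∧
      (∀ x ∈ s, ∀ y ∈ s, (∀ i < n, x.val i = y.val i) → x = y) ∧
      Real.exp (t' * n) < ∑ x ∈ s, Real.exp (sSup (birkhoff (subShift X) φ n ''
        (Subtype.val ⁻¹' cylinder (prefixWord x.val n)))) := by
  let T : ℕ → Set X := fun n => {x | |birkAvg (subShift X) ψ n x - α| ≤ δ}
  let P : (n : ℕ) → (Fin n → A) → Prop := fun n w => ∃ x ∈ T n, initWord n x.val = w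
  let F : ℕ → Finset (List A) := fun n => (Finset.univ.filter (P n)).image List.ofFn
  by_contra! hcon
  refine ht (McalLim_eq_zero_of_covers (F := F) ?_ ?_ htt (m := m) ?_)
  · intro n w hw
    obtain ⟨v, -, rfl⟩ := Finset.mem_image.1 hw
    simp
  · intro x hx k
    have h1 : ∀ᶠ n in atTop, |birkAvg (subShift X) ψ n x - α| ≤ δ := by
      filter_upwards [Metric.tendsto_nhds.1 hx δ hδ] with n hn
      exact (le_of_lt hn)
    obtain ⟨n, hn, hk⟩ := (h1.and (eventually_ge_atTop k)).exists
    refine ⟨n, hk, Finset.mem_image.2 ⟨initWord n x.val, ?_, rfl⟩⟩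
    exact Finset.mem_filter.2 ⟨Finset.mem_univ _, x, hn, rfl⟩
  · intro n hn
    obtain ⟨s, hsT, hinj, himg⟩ := Finset.exists_subset_injOn_image_eq_of_surjOn (T n)
      (Finset.univ.filter (P n)) (f := fun x : X => initWord n x.val) fun w hw =>
        (Finset.mem_filter.1 hw).2
    refine le_trans (le_of_eq ?_) (hcon n hn s (fun x hx => hsT hx) fun x hx y hy hxy =>
      hinj hx hy (funext fun i => hxy i i.2))
    rw [Finset.sum_image List.ofFn_injective.injOn, ← himg, Finset.sum_image hinj]
    rfl

end UpperEstimate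

section LimitMeasure

variable {A : Type} [TopologicalSpace A] [DiscreteTopology A] {X : Set (ℕ → A)}

lemma exists_sSup_birkhoff_le [CompactSpace X] (hX : MapsTo shift X X) {φ : X → ℝ}
    (hφ : Continuous φ) {ε : ℝ} (hε : 0 < ε) :
    ∃ K : ℝ, ∀ (n : ℕ) (x : X), sSup (birkhoff (subShift X) φ n ''
      (Subtype.val ⁻¹' cylinder (prefixWord x.val n))) ≤
        birkhoff (subShift X) φ n x + (ε * n + K) := by
  obtain ⟨S, K, -, hK⟩ := exists_quasiAdd hX hφ (half_pos hε)
  refine ⟨2 * K, fun n x => csSup_le (Set.Nonempty.image _ ⟨x, mem_cylinder_prefixWord x.val n⟩) ?_⟩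
  rintro _ ⟨y, hy, rfl⟩
  have hy' : prefixWord y.val n = prefixWord x.val n := by
    simpa only [length_prefixWord] using mem_cylinder_iff.1 hy
  have h1 := abs_le.1 (hK x n)
  have h2 := abs_le.1 (hK y n)
  rw [hy'] at h2
  linarith [h1.1, h2.2]

variable [Fintype A] [MeasurableSpace A] [BorelSpace A]

lemma exists_gibbs_measure (hX : MapsTo shift X X) {φ ψ : X → ℝ} {α t δ : ℝ} {n : ℕ} (hn : 1 ≤ n)
    {s : Finset X} (hsψ : ∀ x ∈ s, |birkAvg (subShift X) ψ n x - α| ≤ δ)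
    (hs : ∀ x ∈ s, ∀ y ∈ s, (∀ i < n, x.val i = y.val i) → x = y)
    (hsum : Real.exp (t * n) < ∑ x ∈ s, Real.exp (sSup (birkhoff (subShift X) φ n ''
        (Subtype.val ⁻¹' cylinder (prefixWord x.val n))))) :
    ∃ μ : ProbabilityMeasure X, |∫ y, ψ y ∂μ.toMeasure - α| ≤ δ ∧
      (∀ (f : X → ℝ) (C : ℝ), (∀ y, |f y| ≤ C) →
        |∫ y, f (subShift X y) ∂μ.toMeasure - ∫ y, f y ∂μ.toMeasure| ≤ 2 * C / n) ∧
      ∀ D : ℝ, (∀ x : X, sSup (birkhoff (subShift X) φ n ''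
          (Subtype.val ⁻¹' cylinder (prefixWord x.val n))) ≤ birkhoff (subShift X) φ n x + D) →
        ∀ m : ℕ, 1 ≤ m → m * (t * n - D - n * ∫ y, φ y ∂μ.toMeasure) ≤
          n * wordEntropy X μ m + 2 * m ^ 2 * Real.log (Fintype.card A) := by
  have hn0 : (0 : ℝ) < n := by positivity
  set σ := subShift X
  set Z : ℝ := ∑ x ∈ s, Real.exp (birkhoff σ φ n x)
  have hne : s.Nonempty := Finset.nonempty_iff_ne_empty.2 fun h => by
    rw [h, Finset.sum_empty] at hsum
    exact absurd hsum (Real.exp_pos _).not_gt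
  have hZ : 0 < Z := Finset.sum_pos (fun _ _ => Real.exp_pos _) hne
  set q : X → ℝ := fun x => Real.exp (birkhoff σ φ n x) / Z with hqdef
  have hq : ∀ x ∈ s, 0 < q x := fun x _ => by positivity
  have hq1 : ∑ x ∈ s, q x = 1 := by
    simp only [hqdef]
    rw [← Finset.sum_div, div_self hZ.ne']
  obtain ⟨μ, hμ⟩ := exists_orbit_measure σ hn hq hq1
  refine ⟨μ, ?_, ?_, ?_⟩
  · have h1 : ∫ y, ψ y ∂μ.toMeasure - α = ∑ x ∈ s, q x * (birkAvg σ ψ n x - α) := by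
      simp only [mul_sub, Finset.sum_sub_distrib, ← Finset.sum_mul, hq1, one_mul]
      rw [hμ]
      rfl
    rw [h1]
    calc |∑ x ∈ s, q x * (birkAvg σ ψ n x - α)| ≤ ∑ x ∈ s, |q x * (birkAvg σ ψ n x - α)| :=
          Finset.abs_sum_le_sum_abs _ _
      _ ≤ ∑ x ∈ s, q x * δ := Finset.sum_le_sum fun x hx => by
          rw [abs_mul, abs_of_pos (hq x hx)]
          exact mul_le_mul_of_nonneg_left (hsψ x hx) (hq x hx).le
      _ = δ := by rw [← Finset.sum_mul, hq1, one_mul]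
  · intro f C hC
    have h1 : ∫ y, f (σ y) ∂μ.toMeasure - ∫ y, f y ∂μ.toMeasure =
        ∑ x ∈ s, q x * ((n : ℝ)⁻¹ * (f (σ^[n] x) - f x)) := by
      rw [hμ, hμ, ← Finset.sum_sub_distrib]
      refine Finset.sum_congr rfl fun x _ => ?_
      have h2 := Finset.sum_range_sub (fun i => f (σ^[i] x)) n
      rw [Finset.sum_sub_distrib] at h2
      simp only [Function.iterate_succ_apply'] at h2
      rw [← mul_sub, ← mul_sub]
      simp only [birkhoff]
      rw [h2]
      rfl
    rw [h1]
    calc |∑ x ∈ s, q x * ((n : ℝ)⁻¹ * (f (σ^[n] x) - f x))|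
        ≤ ∑ x ∈ s, |q x * ((n : ℝ)⁻¹ * (f (σ^[n] x) - f x))| := Finset.abs_sum_le_sum_abs _ _
      _ ≤ ∑ x ∈ s, q x * (2 * C / n) := Finset.sum_le_sum fun x hx => by
          rw [abs_mul, abs_of_pos (hq x hx), abs_mul, abs_of_pos (inv_pos.2 hn0),
            div_eq_inv_mul (2 * C)]
          have h3 := abs_sub (f (σ^[n] x)) (f x)
          have h4 : |f (σ^[n] x) - f x| ≤ 2 * C := by linarith [hC (σ^[n] x), hC x]
          exact mul_le_mul_of_nonneg_left (mul_le_mul_of_nonneg_left h4 (by positivity))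
            (hq x hx).le
      _ = 2 * C / n := by rw [← Finset.sum_mul, hq1, one_mul]
  · intro D hD m hm
    refine le_trans ?_ (mul_entropy_le_wordEntropy hX hn hs hq hq1 hμ hm)
    refine mul_le_mul_of_nonneg_left ?_ (by positivity)
    have hH : ∑ x ∈ s, Real.negMulLog (q x) = Real.log Z - n * ∫ y, φ y ∂μ.toMeasure := by
      have h1 : ∀ x ∈ s, Real.negMulLog (q x) =
          q x * Real.log Z - n * (q x * ((n : ℝ)⁻¹ * birkhoff σ φ n x)) := by
        intro x _
        rw [Real.negMulLog]
        conv_lhs => rw [hqdef]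
        simp only
        rw [Real.log_div (Real.exp_ne_zero _) hZ.ne', Real.log_exp]
        simp only [hqdef]
        field_simp
        ring
      rw [Finset.sum_congr rfl h1, Finset.sum_sub_distrib, ← Finset.sum_mul, hq1, one_mul,
        ← Finset.mul_sum, ← hμ]
    have hlog : t * n ≤ Real.log Z + D := by
      have h1 : Real.exp (t * n) ≤ Real.exp (Real.log Z + D) := by
        rw [Real.exp_add, Real.exp_log hZ]
        simp only [Z]
        rw [Finset.sum_mul]
        refine hsum.le.trans (Finset.sum_le_sum fun x _ => ?_)
        rw [← Real.exp_add]
        exact Real.exp_le_exp.2 (hD x)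
      exact Real.exp_le_exp.1 h1
    rw [hH]
    linarith

lemma tendsto_wordEntropy {ι : Type*} {l : Filter ι} {μ : ι → ProbabilityMeasure X}
    {ν : ProbabilityMeasure X} (h : Tendsto μ l (𝓝 ν)) (m : ℕ) :
    Tendsto (fun i => wordEntropy X (μ i) m) l (𝓝 (wordEntropy X ν m)) := by
  refine tendsto_finsetSum _ fun w _ => (Real.continuous_negMulLog.tendsto _).comp ?_
  have hclopen : IsClopen (Subtype.val ⁻¹' cylF w : Set X) := by
    rw [cylF_eq_cylinder]
    exact ⟨(isClosed_cylinder _).preimage continuous_subtype_val,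
      (isOpen_cylinder _).preimage continuous_subtype_val⟩
  refine (ENNReal.tendsto_toReal (measure_ne_top _ _)).comp ?_
  exact ProbabilityMeasure.tendsto_measure_of_null_frontier_of_tendsto' h
    (by rw [hclopen.frontier_eq, measure_empty])

lemma exists_invariant_measure [CompactSpace X] (hX : MapsTo shift X X) {φ ψ : X → ℝ}
    (hφ : Continuous φ) (hψ : Continuous ψ) {α t t' : ℝ}
    (ht : McalLim X φ (levelSet (subShift X) ψ α) t ≠ 0) (htt : t' < t) :
    ∃ μ : ProbabilityMeasure X, IsInvariant (subShift X) μ ∧ ∫ y, ψ y ∂μ.toMeasure = α ∧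
      t' ≤ entropy X μ + ∫ y, φ y ∂μ.toMeasure := by
  have hstep : ∀ j : ℕ, ∃ n : ℕ, j + 1 ≤ n ∧ ∃ μ : ProbabilityMeasure X,
      |∫ y, ψ y ∂μ.toMeasure - α| ≤ 1 / ((j : ℝ) + 1) ∧
      (∀ (f : X → ℝ) (C : ℝ), (∀ y, |f y| ≤ C) →
        |∫ y, f (subShift X y) ∂μ.toMeasure - ∫ y, f y ∂μ.toMeasure| ≤ 2 * C / n) ∧
      ∀ D : ℝ, (∀ x : X, sSup (birkhoff (subShift X) φ n ''
          (Subtype.val ⁻¹' cylinder (prefixWord x.val n))) ≤ birkhoff (subShift X) φ n x + D) →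
        ∀ m : ℕ, 1 ≤ m → m * (t' * n - D - n * ∫ y, φ y ∂μ.toMeasure) ≤
          n * wordEntropy X μ m + 2 * m ^ 2 * Real.log (Fintype.card A) := by
    intro j
    obtain ⟨n, hn, s, hsψ, hs, hsum⟩ :=
      exists_large_sum ht htt (δ := 1 / ((j : ℝ) + 1)) (by positivity) (j + 1)
    exact ⟨n, hn, exists_gibbs_measure hX (by omega) hsψ hs hsum⟩
  choose N hN μ hμψ hμσ hμH using hstep
  obtain ⟨ν, -, hν⟩ := (isCompact_univ (X := ProbabilityMeasure X)).ultrafilter_le_nhds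
    ((hyperfilter ℕ).map μ) (by simp)
  have hν : Tendsto μ (hyperfilter ℕ : Filter ℕ) (𝓝 ν) := hν
  have hf_int : ∀ f : X → ℝ, Continuous f → Tendsto (fun j => ∫ y, f y ∂(μ j).toMeasure)
      (hyperfilter ℕ : Filter ℕ) (𝓝 (∫ y, f y ∂ν.toMeasure)) := fun f hf =>
    ProbabilityMeasure.tendsto_iff_forall_integral_tendsto.1 hν
      (BoundedContinuousFunction.mkOfCompact ⟨f, hf⟩)
  have hNat : Tendsto (fun j => (N j : ℝ)) (hyperfilter ℕ : Filter ℕ) atTop :=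
    (tendsto_natCast_atTop_atTop.comp (tendsto_atTop_mono
      (fun j => (Nat.le_succ j).trans (hN j)) tendsto_id)).mono_left Nat.hyperfilter_le_atTop
  have hdiv : ∀ c : ℝ, Tendsto (fun j => c / N j) (hyperfilter ℕ : Filter ℕ) (𝓝 0) := fun c =>
    hNat.const_div_atTop c
  have hcont := continuous_subShift hX
  refine ⟨ν, ?_, ?_, ?_⟩
  · refine ext_of_forall_integral_eq_of_IsFiniteMeasure fun f => ?_
    rw [integral_map hcont.measurable.aemeasurable f.continuous.aestronglyMeasurable]
    refine sub_eq_zero.1 (abs_nonpos_iff.1 (le_of_tendsto_of_tendsto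
      ((hf_int _ (f.continuous.comp hcont)).sub (hf_int _ f.continuous)).abs (hdiv (2 * ‖f‖))
      (Eventually.of_forall fun j => ?_)))
    exact hμσ j f ‖f‖ f.norm_coe_le_norm
  · refine sub_eq_zero.1 (abs_nonpos_iff.1 (le_of_tendsto_of_tendsto
      ((hf_int _ hψ).sub_const α).abs
      (tendsto_one_div_add_atTop_nhds_zero_nat.mono_left Nat.hyperfilter_le_atTop)
      (Eventually.of_forall hμψ)))
  · rw [← sub_le_iff_le_add]
    refine le_ciInf fun k => ?_
    rw [le_div_iff₀ (by positivity)]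
    refine le_of_forall_pos_le_add fun η hη => ?_
    set ε : ℝ := η / (k + 1) with hε
    obtain ⟨K, hK⟩ := exists_sSup_birkhoff_le hX hφ (ε := ε) (by positivity)
    have hlim1 := (((hdiv K).const_sub (t' - ε)).sub (hf_int _ hφ)).mul_const ((k : ℝ) + 1)
    have hlim2 := (tendsto_wordEntropy hν (k + 1)).add
      (hdiv (2 * ((k : ℝ) + 1) ^ 2 * Real.log (Fintype.card A)))
    have := le_of_tendsto_of_tendsto hlim1 hlim2 (Eventually.of_forall fun j => by
      have hNj : (0 : ℝ) < N j := by
        have := hN j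
        exact_mod_cast (by omega : 0 < N j)
      have h1 := hμH j _ (hK (N j)) (k + 1) (by omega)
      push_cast at h1
      rw [← mul_le_mul_iff_right₀ hNj]
      field_simp
      linarith)
    have h2 : ε * ((k : ℝ) + 1) = η := by rw [hε]; field_simp
    linarith

end LimitMeasure

section EntropyBound

variable {A : Type} [Fintype A] [MeasurableSpace A] {X : Set (ℕ → A)}

lemma entropy_le_card (μ : ProbabilityMeasure X) : entropy X μ ≤ Fintype.card A := by
  have h1 := mul_entropy_le μ le_rfl
  rw [Nat.cast_one, one_mul] at h1
  refine h1.trans ?_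
  calc wordEntropy X μ 1 ≤ ∑ _w : Fin 1 → A, (1 : ℝ) := Finset.sum_le_sum fun w _ => by
        set p := (μ.toMeasure (Subtype.val ⁻¹' cylF w)).toReal
        have hp : 0 ≤ p := ENNReal.toReal_nonneg
        linarith [Real.negMulLog_le_one_sub_self hp]
    _ = Fintype.card A := by simp

end EntropyBound

/-- conditional variational principle for the pressure of level sets. -/
theorem statement_12 {A : Type} [Fintype A] [DecidableEq A] [TopologicalSpace A]
    [DiscreteTopology A] [MeasurableSpace A] [BorelSpace A]
    (X : Set (ℕ → A)) (hXcl : IsClosed X) (hXinv : Set.MapsTo shift X X)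
    (φ : ↥X → ℝ) (hφ : Continuous φ)
    (G : Set (List A)) (hG : G ⊆ language X)
    (hspec : HasSpecW (language X) G) (happ : EditApproachable (language X) G)
    (ψ : ↥X → ℝ) (hψ : Continuous ψ) (α : ℝ) :
    pressure X φ (levelSet (subShift X) ψ α) =
      sSup {r : ℝ | ∃ μ : ProbabilityMeasure ↥X, IsInvariant (subShift X) μ ∧
        (∫ x, ψ x ∂μ.toMeasure) = α ∧ r = entropy X μ + ∫ x, φ x ∂μ.toMeasure} := by
  have : CompactSpace X := compactSpace_of_isClosed hXcl
  set R := {r : ℝ | ∃ μ : ProbabilityMeasure ↥X, IsInvariant (subShift X) μ ∧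
    (∫ x, ψ x ∂μ.toMeasure) = α ∧ r = entropy X μ + ∫ x, φ x ∂μ.toMeasure}
  have hU : ∀ t t' : ℝ, t' < t → (∀ r ∈ R, r < t') →
      McalLim X φ (levelSet (subShift X) ψ α) t = 0 := by
    intro t t' htt hR
    by_contra ht
    obtain ⟨μ, hμ, hμψ, hle⟩ := exists_invariant_measure hXinv hφ hψ ht htt
    exact (hR _ ⟨μ, hμ, hμψ, rfl⟩).not_ge hle
  rw [pressure]
  rcases R.eq_empty_or_nonempty with hR | hR
  · have huniv : {t : ℝ | McalLim X φ (levelSet (subShift X) ψ α) t = 0} = univ :=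
      eq_univ_of_forall fun t => hU t (t - 1) (by linarith) (by simp [hR])
    rw [huniv, hR, Real.sInf_univ, Real.sSup_empty]
  obtain ⟨C, -, hC⟩ := exists_abs_le hφ
  have hbdd : BddAbove R := by
    refine ⟨Fintype.card A + C, ?_⟩
    rintro _ ⟨μ, -, -, rfl⟩
    refine add_le_add (entropy_le_card μ) ((le_abs_self _).trans ?_)
    have := norm_integral_le_of_norm_le_const (μ := μ.toMeasure) (f := φ)
      (Eventually.of_forall hC)
    simpa using this
  have hlub : ∀ t, sSup R < t → McalLim X φ (levelSet (subShift X) ψ α) t = 0 := fun t ht =>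
    hU t ((sSup R + t) / 2) (by linarith) fun r hr =>
      (le_csSup hbdd hr).trans_lt (by linarith)
  have hlb : ∀ t ∈ {t : ℝ | McalLim X φ (levelSet (subShift X) ψ α) t = 0}, sSup R ≤ t := by
    intro t ht
    refine csSup_le hR ?_
    rintro _ ⟨μ, hμ, rfl, rfl⟩
    exact le_of_McalLim_levelSet_eq_zero hXinv hG hspec happ hμ hφ hψ ht
  refine le_antisymm (le_of_forall_gt_imp_ge_of_dense fun t ht => csInf_le ⟨_, hlb⟩ (hlub t ht))
    (le_csInf ⟨sSup R + 1, hlub _ (by linarith)⟩ hlb)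

end Paper
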